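/- arXiv:math/0303068 — 3 statements merged into one kernel-verified Lean document; each statement's English description precedes it below -/
import Mathlib

section
/- Under the standing assumptions with σ taking values in k, fix q ≥ 0 and set M_q = H⊗A^{⊗(q+1)}. Then the formulas overline{h}·(g⊗a_0⊗⋯⊗a_q) = σ(h^{(q+3)},g⁽²⁾) h^{(q+2)}g⁽¹⁾ ⊗ h⁽¹⁾(a_0)⊗⋯⊗h^{(q+1)}(a_q) and (g⊗a_0⊗⋯⊗a_q)·overline{h} = σ(g⁽²⁾,h⁽²⁾) g⁽¹⁾h⁽¹⁾ ⊗ a_0⊗⋯⊗a_q define an H_σ-bimodule structure on M_q: the left formula defines a left H_σ-module, the right formula defines a right H_σ-module, and the two actions commute. -/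
open TensorProduct

noncomputable section

/-! ## Tensor powers, iterated comultiplication and Sweedler representations -/

/-- `Tpow k V n` is the `(n+1)`-fold tensor power `V ⊗ V ⊗ ⋯ ⊗ V` (`n+1` factors),
bundled as an object of `ModuleCat k`. -/
def Tpow (k : Type) [Field k] (V : Type) [AddCommGroup V] [Module k V] : ℕ → ModuleCat k
  | 0 => ModuleCat.of k V
  | n + 1 => ModuleCat.of k (V ⊗[k] (Tpow k V n))

/-- The elementary tensor `f 0 ⊗ f 1 ⊗ ⋯ ⊗ f n` in `Tpow k V n`. -/
def tpow (k : Type) [Field k] (V : Type) [AddCommGroup V] [Module k V] :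
    (n : ℕ) → (Fin (n + 1) → V) → Tpow k V n
  | 0, f => (f 0 : V)
  | n + 1, f => (f 0 ⊗ₜ[k] tpow k V n (fun i => f i.succ) : V ⊗[k] Tpow k V n)

/-- The iterated comultiplication `Δ⁽ⁿ⁾ : H → H^{⊗(n+1)}`, `Δ⁽⁰⁾ = id`,
`Δ⁽ⁿ⁺¹⁾ = (1 ⊗ Δ⁽ⁿ⁾) ∘ Δ`. -/
def comulIter (k : Type) [Field k] (H : Type) [Ring H] [HopfAlgebra k H] :
    (n : ℕ) → H →ₗ[k] Tpow k H n
  | 0 => LinearMap.id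
  | n + 1 =>
    (LinearMap.lTensor H (comulIter k H n) ∘ₗ Coalgebra.comul :
      H →ₗ[k] (H ⊗[k] Tpow k H n))

/-- A finite Sweedler-type representation `Δ⁽ⁿ⁾ h = ∑ᵢ h⁽¹⁾ᵢ ⊗ ⋯ ⊗ h⁽ⁿ⁺¹⁾ᵢ` of the iterated
comultiplication of `h`; `leg i j` is the `(j+1)`-st Sweedler leg of the `i`-th summand. -/
structure IterRepr (k : Type) [Field k] (H : Type) [Ring H] [HopfAlgebra k H]
    (n : ℕ) (h : H) where
  ι : Type
  s : Finset ι
  leg : ι → Fin (n + 1) → H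
  eq : ∑ i ∈ s, tpow k H n (leg i) = comulIter k H n h

/-- Merge an `(n+1)`-tuple to an `n`-tuple, replacing the two entries at positions `i, i+1`
by the single entry `v`. -/
def mergeAt {V : Type} {n : ℕ} (i : Fin n) (x : Fin (n + 1) → V) (v : V) :
    Fin n → V :=
  fun j => if (j : ℕ) < (i : ℕ) then x (Fin.castSucc j) else
    if (j : ℕ) = (i : ℕ) then v else x j.succ

variable (k : Type) [Field k] (H : Type) [Ring H] [HopfAlgebra k H]

/-- `H` is cocommutative. -/
def Cocomm : Prop :=
  ∀ h : H, (TensorProduct.comm k H H) (Coalgebra.comul (R := k) h) = Coalgebra.comul (R := k) h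

variable (A : Type) [Ring A] [Algebra k A]
variable (rho : H →ₗ[k] A →ₗ[k] A)

/-- `rho` is a weak action of `H` on `A`:
`h(ab) = h⁽¹⁾(a)h⁽²⁾(b)`, `h(1) = ε(h)1` and `1(a) = a`. -/
def IsWeakAction : Prop :=
  (∀ (h : H) (a b : A) (R : IterRepr k H 1 h),
      rho h (a * b) = ∑ i ∈ R.s, rho (R.leg i 0) a * rho (R.leg i 1) b) ∧
  (∀ h : H, rho h (1 : A) = Coalgebra.counit (R := k) h • (1 : A)) ∧
  (∀ a : A, rho 1 a = a)

/-- `rho` makes `A` a left `H`-module algebra: a weak action which is an action. -/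
def IsModuleAlgebraAction : Prop :=
  IsWeakAction k H A rho ∧ (∀ (h l : H) (a : A), rho (h * l) a = rho h (rho l a))

variable (sg : H →ₗ[k] H →ₗ[k] k)

/-- Normality for a `k`-valued cocycle: `σ(h,1) = σ(1,h) = ε(h)`. -/
def NormalK : Prop :=
  ∀ h : H, sg h 1 = Coalgebra.counit (R := k) h ∧ sg 1 h = Coalgebra.counit (R := k) h

/-- The cocycle property for a `k`-valued cocycle:
`σ(l⁽¹⁾,m⁽¹⁾)σ(h,l⁽²⁾m⁽²⁾) = σ(h⁽¹⁾,l⁽¹⁾)σ(h⁽²⁾l⁽²⁾,m)`. -/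
def CocycleK : Prop :=
  ∀ (h l m : H) (Rh : IterRepr k H 1 h) (Rl : IterRepr k H 1 l) (Rm : IterRepr k H 1 m),
    ∑ j ∈ Rl.s, ∑ c ∈ Rm.s,
        sg (Rl.leg j 0) (Rm.leg c 0) * sg h (Rl.leg j 1 * Rm.leg c 1) =
      ∑ i ∈ Rh.s, ∑ j ∈ Rl.s,
        sg (Rh.leg i 0) (Rl.leg j 0) * sg (Rh.leg i 1 * Rl.leg j 1) m

/-- The twisted module property for a `k`-valued cocycle:
`h⁽¹⁾(l⁽¹⁾(a))σ(h⁽²⁾,l⁽²⁾) = σ(h⁽¹⁾,l⁽¹⁾)(h⁽²⁾l⁽²⁾)(a)`. -/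
def TwistedModuleK : Prop :=
  ∀ (h l : H) (a : A) (Rh : IterRepr k H 1 h) (Rl : IterRepr k H 1 l),
    ∑ i ∈ Rh.s, ∑ j ∈ Rl.s,
        sg (Rh.leg i 1) (Rl.leg j 1) • rho (Rh.leg i 0) (rho (Rl.leg j 0) a) =
      ∑ i ∈ Rh.s, ∑ j ∈ Rl.s,
        sg (Rh.leg i 0) (Rl.leg j 0) • rho (Rh.leg i 1 * Rl.leg j 1) a

/-- The `k`-valued map `σ`, viewed in the convolution algebra `Hom_k(H ⊗ H, A)` via
`x ⊗ y ↦ σ(x,y)1_A`, is convolution invertible. -/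
def ConvInvertibleK : Prop :=
  ∃ sg' : H →ₗ[k] H →ₗ[k] A,
    ∀ (h l : H) (Rh : IterRepr k H 1 h) (Rl : IterRepr k H 1 l),
      (∑ i ∈ Rh.s, ∑ j ∈ Rl.s,
          (sg (Rh.leg i 0) (Rl.leg j 0) • (1 : A)) * sg' (Rh.leg i 1) (Rl.leg j 1) =
        (Coalgebra.counit (R := k) h * Coalgebra.counit (R := k) l) • (1 : A)) ∧
      (∑ i ∈ Rh.s, ∑ j ∈ Rl.s,
          sg' (Rh.leg i 0) (Rl.leg j 0) * (sg (Rh.leg i 1) (Rl.leg j 1) • (1 : A)) =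
        (Coalgebra.counit (R := k) h * Coalgebra.counit (R := k) l) • (1 : A))

/-! ## The twisted algebra `H_σ = k #_σ H` and `H_σ`-bimodules -/

variable (M : Type) [AddCommGroup M] [Module k M]
variable (mu : H →ₗ[k] H →ₗ[k] H) (sg' : H →ₗ[k] H →ₗ[k] k)
variable (lact ract : H →ₗ[k] M →ₗ[k] M)

/-- Spec of the multiplication of the twisted algebra `H_σ = k #_σ H` (underlying space `H`):
`h̄ · ḡ = σ(h⁽¹⁾,g⁽¹⁾) (h⁽²⁾g⁽²⁾)‾`. -/
def IsTwistMul : Prop :=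
  ∀ (h g : H) (Rh : IterRepr k H 1 h) (Rg : IterRepr k H 1 g),
    mu h g = ∑ i ∈ Rh.s, ∑ j ∈ Rg.s,
      sg (Rh.leg i 0) (Rg.leg j 0) • (Rh.leg i 1 * Rg.leg j 1)

/-- `sg'` is the convolution inverse of `sg` in the convolution algebra `Hom_k(H ⊗ H, k)`. -/
def IsConvInvPair : Prop :=
  ∀ (h l : H) (Rh : IterRepr k H 1 h) (Rl : IterRepr k H 1 l),
    (∑ i ∈ Rh.s, ∑ j ∈ Rl.s,
        sg (Rh.leg i 0) (Rl.leg j 0) * sg' (Rh.leg i 1) (Rl.leg j 1) =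
      Coalgebra.counit (R := k) h * Coalgebra.counit (R := k) l) ∧
    (∑ i ∈ Rh.s, ∑ j ∈ Rl.s,
        sg' (Rh.leg i 0) (Rl.leg j 0) * sg (Rh.leg i 1) (Rl.leg j 1) =
      Coalgebra.counit (R := k) h * Coalgebra.counit (R := k) l)

/-- `(lact, ract)` is an `H_σ`-bimodule structure on `M` (where `H_σ` has multiplication `mu`
and unit `1̄ = 1`): commuting left and right `H_σ`-module structures. -/
def IsSigmaBimodule : Prop :=
  (∀ (h h' : H) (m : M), lact h (lact h' m) = lact (mu h h') m) ∧
  (∀ m : M, lact 1 m = m) ∧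
  (∀ (h h' : H) (m : M), ract h' (ract h m) = ract (mu h h') m) ∧
  (∀ m : M, ract 1 m = m) ∧
  (∀ (h h' : H) (m : M), lact h (ract h' m) = ract h' (lact h m))

/-- Spec of the operation `h ▶ m = σ⁻¹(S(h⁽²⁾),h⁽³⁾) · (h⁽⁴⁾)‾ m (S(h⁽¹⁾))‾`. -/
def IsTriangle (B : H →ₗ[k] M →ₗ[k] M) : Prop :=
  ∀ (h : H) (m : M) (R : IterRepr k H 3 h),
    B h m = ∑ i ∈ R.s,
      sg' (HopfAlgebra.antipode (R := k) (R.leg i 1)) (R.leg i 2) •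
        lact (R.leg i 3) (ract (HopfAlgebra.antipode (R := k) (R.leg i 0)) m)

/-- `TpowM k H M n` is `H^{⊗n} ⊗ M` (with `n` factors of `H`). -/
def TpowM (k : Type) [Field k] (H : Type) [Ring H] [HopfAlgebra k H]
    (M : Type) [AddCommGroup M] [Module k M] : ℕ → ModuleCat k
  | 0 => ModuleCat.of k M
  | n + 1 => ModuleCat.of k (H ⊗[k] (TpowM k H M n))

/-- The elementary tensor `f 0 ⊗ ⋯ ⊗ f (n-1) ⊗ m` in `TpowM k H M n`. -/
def tpowM (k : Type) [Field k] (H : Type) [Ring H] [HopfAlgebra k H]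
    (M : Type) [AddCommGroup M] [Module k M] :
    (n : ℕ) → (Fin n → H) → M → TpowM k H M n
  | 0, _, m => (m : M)
  | n + 1, f, m =>
    (f 0 ⊗ₜ[k] tpowM k H M n (fun i => f i.succ) m : H ⊗[k] TpowM k H M n)

/-- Spec of the `0`-th face of the Hochschild complex `C_•(H_σ, M)`:
`δ₀(h̄₁ ⊗ ⋯ ⊗ h̄_{n+1} ⊗ m) = h̄₂ ⊗ ⋯ ⊗ h̄_{n+1} ⊗ m·h̄₁`. -/
def IsHochFace0 (n : ℕ) (D : (TpowM k H M (n + 1) : Type) →ₗ[k] (TpowM k H M n : Type)) :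
    Prop :=
  ∀ (f : Fin (n + 1) → H) (m : M),
    D (tpowM k H M (n + 1) f m) = tpowM k H M n (fun i => f i.succ) (ract (f 0) m)

/-- Spec of the middle face `δ_{i+1}` (`0 ≤ i < n`) of the Hochschild complex `C_•(H_σ, M)`:
it multiplies `h̄_{i+1}·h̄_{i+2}` in `H_σ`. -/
def IsHochFaceMid (n : ℕ) (i : Fin n)
    (D : (TpowM k H M (n + 1) : Type) →ₗ[k] (TpowM k H M n : Type)) : Prop :=
  ∀ (f : Fin (n + 1) → H) (m : M),
    D (tpowM k H M (n + 1) f m) =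
      tpowM k H M n (mergeAt i f (mu (f i.castSucc) (f i.succ))) m

/-- Spec of the last face of the Hochschild complex `C_•(H_σ, M)`:
`δ_{n+1}(h̄₁ ⊗ ⋯ ⊗ h̄_{n+1} ⊗ m) = h̄₁ ⊗ ⋯ ⊗ h̄ₙ ⊗ h̄_{n+1}·m`. -/
def IsHochFaceLast (n : ℕ)
    (D : (TpowM k H M (n + 1) : Type) →ₗ[k] (TpowM k H M n : Type)) : Prop :=
  ∀ (f : Fin (n + 1) → H) (m : M),
    D (tpowM k H M (n + 1) f m) =
      tpowM k H M n (fun i => f i.castSucc) (lact (f (Fin.last n)) m)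

/-- Spec of the degeneracy inserting the unit `1` at slot `i`
(the same formula in both complexes, since `1̄ = 1`). -/
def IsDegen (n : ℕ) (i : Fin (n + 1))
    (D : (TpowM k H M n : Type) →ₗ[k] (TpowM k H M (n + 1) : Type)) : Prop :=
  ∀ (f : Fin n → H) (m : M),
    D (tpowM k H M n f m) = tpowM k H M (n + 1) (i.insertNth 1 f) m

/-- Spec of the `0`-th face of the Hopf homology complex `C_•(H; M̃)`:
`d₀(h₁ ⊗ ⋯ ⊗ h_{n+1} ⊗ m) = ε(h₁) h₂ ⊗ ⋯ ⊗ h_{n+1} ⊗ m`. -/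
def IsHopfFace0 (n : ℕ) (D : (TpowM k H M (n + 1) : Type) →ₗ[k] (TpowM k H M n : Type)) :
    Prop :=
  ∀ (f : Fin (n + 1) → H) (m : M),
    D (tpowM k H M (n + 1) f m) =
      Coalgebra.counit (R := k) (f 0) • tpowM k H M n (fun i => f i.succ) m

/-- Spec of the middle face `d_{i+1}` (`0 ≤ i < n`) of the Hopf homology complex
`C_•(H; M̃)`: it multiplies `h_{i+1}h_{i+2}` in `H`. -/
def IsHopfFaceMid (n : ℕ) (i : Fin n)
    (D : (TpowM k H M (n + 1) : Type) →ₗ[k] (TpowM k H M n : Type)) : Prop :=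
  ∀ (f : Fin (n + 1) → H) (m : M),
    D (tpowM k H M (n + 1) f m) =
      tpowM k H M n (mergeAt i f (f i.castSucc * f i.succ)) m

/-- Spec of the last face of the Hopf homology complex `C_•(H; M̃)`:
`d_{n+1}(h₁ ⊗ ⋯ ⊗ h_{n+1} ⊗ m) = h₁ ⊗ ⋯ ⊗ hₙ ⊗ h_{n+1} ▶ m`. -/
def IsHopfFaceLast (B : H →ₗ[k] M →ₗ[k] M) (n : ℕ)
    (D : (TpowM k H M (n + 1) : Type) →ₗ[k] (TpowM k H M n : Type)) : Prop :=
  ∀ (f : Fin (n + 1) → H) (m : M),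
    D (tpowM k H M (n + 1) f m) =
      tpowM k H M n (fun i => f i.castSucc) (B (f (Fin.last n)) m)

/-- Spec of the map `Θ : C_n(H_σ, M) → C_n(H; M̃)`:
`Θ(h̄₁ ⊗ ⋯ ⊗ h̄ₙ ⊗ m) = h₁⁽²⁾ ⊗ ⋯ ⊗ hₙ⁽²⁾ ⊗ m·h̄₁⁽¹⁾⋯h̄ₙ⁽¹⁾`. -/
def IsTheta (n : ℕ) (Th : (TpowM k H M n : Type) →ₗ[k] (TpowM k H M n : Type)) : Prop :=
  ∀ (f : Fin n → H) (m : M) (R : ∀ i : Fin n, IterRepr k H 1 (f i)),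
    Th (tpowM k H M n f m) =
      ∑ e ∈ Fintype.piFinset (fun i => (R i).s),
        tpowM k H M n (fun i => (R i).leg (e i) 1)
          ((List.ofFn (fun i : Fin n => (R i).leg (e i) 0)).foldl
            (fun m' h => ract h m') m)

/-- Spec of the map `𝔗 : C_n(H; M̃) → C_n(H_σ, M)`:
`𝔗(h₁ ⊗ ⋯ ⊗ hₙ ⊗ m) = σ⁻¹(S(h₁⁽²⁾),h₁⁽³⁾)⋯σ⁻¹(S(hₙ⁽²⁾),hₙ⁽³⁾) ·
h̄₁⁽⁴⁾ ⊗ ⋯ ⊗ h̄ₙ⁽⁴⁾ ⊗ m·(S(hₙ⁽¹⁾))‾⋯(S(h₁⁽¹⁾))‾`. -/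
def IsTfrak (n : ℕ) (T : (TpowM k H M n : Type) →ₗ[k] (TpowM k H M n : Type)) : Prop :=
  ∀ (f : Fin n → H) (m : M) (R : ∀ i : Fin n, IterRepr k H 3 (f i)),
    T (tpowM k H M n f m) =
      ∑ e ∈ Fintype.piFinset (fun i => (R i).s),
        (∏ i : Fin n,
            sg' (HopfAlgebra.antipode (R := k) ((R i).leg (e i) 1)) ((R i).leg (e i) 2)) •
          tpowM k H M n (fun i => (R i).leg (e i) 3)
            (((List.ofFn (fun i : Fin n => (R i).leg (e i) 0)).reverse).foldl
              (fun m' h => ract (HopfAlgebra.antipode (R := k) h) m') m)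

variable (q : ℕ)

/-- Spec of the left `H_σ`-action on `M_q = H ⊗ A^{⊗(q+1)}`:
`h̄·(g ⊗ a₀ ⊗ ⋯ ⊗ a_q) = σ(h^{(q+3)},g⁽²⁾) h^{(q+2)}g⁽¹⁾ ⊗ h⁽¹⁾(a₀) ⊗ ⋯ ⊗ h^{(q+1)}(a_q)`. -/
def IsLeftActMq
    (L : H →ₗ[k] (H ⊗[k] (Tpow k A q : Type)) →ₗ[k] (H ⊗[k] (Tpow k A q : Type))) : Prop :=
  ∀ (h g : H) (a : Fin (q + 1) → A)
    (Rh : IterRepr k H (q + 2) h) (Rg : IterRepr k H 1 g),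
    L h (g ⊗ₜ[k] tpow k A q a) =
      ∑ i ∈ Rh.s, ∑ j ∈ Rg.s,
        sg (Rh.leg i (Fin.last (q + 2))) (Rg.leg j 1) •
          ((Rh.leg i ⟨q + 1, by omega⟩ * Rg.leg j 0) ⊗ₜ[k]
            tpow k A q (fun c : Fin (q + 1) =>
              rho (Rh.leg i (Fin.castLE (by omega) c)) (a c)))

/-- Spec of the right `H_σ`-action on `M_q = H ⊗ A^{⊗(q+1)}`:
`(g ⊗ a₀ ⊗ ⋯ ⊗ a_q)·h̄ = σ(g⁽²⁾,h⁽²⁾) g⁽¹⁾h⁽¹⁾ ⊗ a₀ ⊗ ⋯ ⊗ a_q`. -/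
def IsRightActMq
    (Rt : H →ₗ[k] (H ⊗[k] (Tpow k A q : Type)) →ₗ[k] (H ⊗[k] (Tpow k A q : Type))) : Prop :=
  ∀ (h g : H) (a : Fin (q + 1) → A)
    (Rg : IterRepr k H 1 g) (Rh : IterRepr k H 1 h),
    Rt h (g ⊗ₜ[k] tpow k A q a) =
      ∑ j ∈ Rg.s, ∑ i ∈ Rh.s,
        sg (Rg.leg j 1) (Rh.leg i 1) •
          ((Rg.leg j 0 * Rh.leg i 0) ⊗ₜ[k] tpow k A q a)

section SweedlerSums

open Coalgebra

variable {k H} {P : Type} [AddCommGroup P]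

/-- The Sweedler sum `f(h⁽¹⁾, h⁽²⁾)`, evaluated on a chosen representation of `Δ(h)`. -/
def sweedlerSum (k : Type) [Field k] {H : Type} [Ring H] [HopfAlgebra k H]
    {P : Type} [AddCommGroup P] (h : H) (f : H → H → P) : P :=
  ∑ i ∈ (ℛ k h).index, f ((ℛ k h).left i) ((ℛ k h).right i)

lemma sweedlerSum_congr {h : H} {f g : H → H → P} (hfg : ∀ a b, f a b = g a b) :
    sweedlerSum k h f = sweedlerSum k h g :=
  Finset.sum_congr rfl fun _ _ => hfg _ _

lemma sweedlerSum_add_fun (h : H) (f g : H → H → P) :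
    sweedlerSum k h (fun a b => f a b + g a b) = sweedlerSum k h f + sweedlerSum k h g :=
  Finset.sum_add_distrib

lemma sweedlerSum_comm (h l : H) (f : H → H → H → H → P) :
    (sweedlerSum k h fun a b => sweedlerSum k l fun c d => f a b c d) =
      sweedlerSum k l fun c d => sweedlerSum k h fun a b => f a b c d :=
  Finset.sum_comm

lemma comulIter_one (h : H) : comulIter k H 1 h = (comul h : H ⊗[k] H) :=
  LinearMap.lTensor_id_apply H H (comul h)

/-- The chosen representation of `Δ(h)`, as a representation of the iterated comultiplication. -/
def IterRepr.ofRepr (k : Type) [Field k] {H : Type} [Ring H] [HopfAlgebra k H] (h : H) :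
    IterRepr k H 1 h where
  ι := H × H
  s := (ℛ k h).index
  leg i := ![(ℛ k h).left i, (ℛ k h).right i]
  eq := (ℛ k h).eq.trans (comulIter_one h).symm

variable [Module k P] {Q : Type} [AddCommGroup Q] [Module k Q]

/-- The map `f` is linear in each of its two arguments. -/
structure IsBilin (k : Type) [Field k] {H P : Type} [AddCommGroup H] [Module k H]
    [AddCommGroup P] [Module k P] (f : H → H → P) : Prop where
  fst : ∀ b, IsLinearMap k fun a => f a b
  snd : ∀ a, IsLinearMap k fun b => f a b

/-- The map `f` is linear in each of its three arguments. -/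
structure IsTrilin (k : Type) [Field k] {H P : Type} [AddCommGroup H] [Module k H]
    [AddCommGroup P] [Module k P] (f : H → H → H → P) : Prop where
  fst : ∀ b c, IsLinearMap k fun a => f a b c
  snd : ∀ a c, IsLinearMap k fun b => f a b c
  thd : ∀ a b, IsLinearMap k fun c => f a b c

/-- The bundled bilinear map attached to `f`. -/
def IsBilin.toLinearMap {f : H → H → P} (hf : IsBilin k f) : H →ₗ[k] H →ₗ[k] P :=
  LinearMap.mk₂ k f (fun a a' b => (hf.fst b).map_add a a') (fun c a b => (hf.fst b).map_smul c a)
    (fun a b b' => (hf.snd a).map_add b b') (fun c a b => (hf.snd a).map_smul c b)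

@[simp]
lemma IsBilin.toLinearMap_apply {f : H → H → P} (hf : IsBilin k f) (a b : H) :
    hf.toLinearMap a b = f a b := rfl

/-- The bundled trilinear map attached to `f`. -/
def IsTrilin.toLinearMap {f : H → H → H → P} (hf : IsTrilin k f) :
    H →ₗ[k] H →ₗ[k] H →ₗ[k] P :=
  LinearMap.mk₂ k (fun a b => (hf.thd a b).mk')
    (fun a a' b => LinearMap.ext fun c => (hf.fst b c).map_add a a')
    (fun r a b => LinearMap.ext fun c => (hf.fst b c).map_smul r a)
    (fun a b b' => LinearMap.ext fun c => (hf.snd a c).map_add b b')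
    (fun r a b => LinearMap.ext fun c => (hf.snd a c).map_smul r b)

@[simp]
lemma IsTrilin.toLinearMap_apply {f : H → H → H → P} (hf : IsTrilin k f) (a b c : H) :
    hf.toLinearMap a b c = f a b c := rfl

lemma sweedlerSum_eq_lift (h : H) (F : H →ₗ[k] H →ₗ[k] P) :
    sweedlerSum k h (fun a b => F a b) = TensorProduct.lift F (comul h) := by
  rw [← (ℛ k h).eq, map_sum]
  simp [sweedlerSum]

lemma IsBilin.sweedlerSum_eq {f : H → H → P} (hf : IsBilin k f) (h : H) :
    sweedlerSum k h f = TensorProduct.lift hf.toLinearMap (comul h) :=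
  sweedlerSum_eq_lift h hf.toLinearMap

lemma sweedlerSum_smul_fun (h : H) (c : k) (f : H → H → P) :
    sweedlerSum k h (fun a b => c • f a b) = c • sweedlerSum k h f :=
  Finset.smul_sum.symm

lemma map_sweedlerSum (T : P →ₗ[k] Q) (h : H) (f : H → H → P) :
    T (sweedlerSum k h f) = sweedlerSum k h fun a b => T (f a b) :=
  map_sum T _ _

lemma IsBilin.isLinearMap_sweedlerSum {f : H → H → P} (hf : IsBilin k f) :
    IsLinearMap k fun h => sweedlerSum k h f := by
  simp only [hf.sweedlerSum_eq]
  exact (TensorProduct.lift hf.toLinearMap ∘ₗ comul).isLinear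

lemma isLinearMap_sweedlerSum_fun (h : H) {f : Q → H → H → P}
    (hf : ∀ a b, IsLinearMap k fun x => f x a b) :
    IsLinearMap k fun x => sweedlerSum k h (f x) where
  map_add x y := by
    rw [← sweedlerSum_add_fun]
    exact sweedlerSum_congr fun a b => (hf a b).map_add x y
  map_smul c x := by
    rw [← sweedlerSum_smul_fun]
    exact sweedlerSum_congr fun a b => (hf a b).map_smul c x

lemma IsBilin.sweedlerSum_flip (hco : Cocomm k H) {f : H → H → P} (hf : IsBilin k f) (h : H) :
    (sweedlerSum k h fun a b => f b a) = sweedlerSum k h f := by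
  rw [hf.sweedlerSum_eq, ← hco h, ← (ℛ k h).eq]
  simp [sweedlerSum]

lemma IsTrilin.sweedlerSum_assoc {f : H → H → H → P} (hf : IsTrilin k f) (h : H) :
    (sweedlerSum k h fun a b => sweedlerSum k a fun c d => f c d b) =
      sweedlerSum k h fun a b => sweedlerSum k b fun c d => f a c d := by
  have := congrArg
    (TensorProduct.lift ((TensorProduct.lift.equiv (.id k) H H P).toLinearMap ∘ₗ hf.toLinearMap))
    (sum_tmul_tmul_eq (ℛ k h) (fun i => ℛ k _) (fun i => ℛ k _))
  simpa [sweedlerSum] using this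

lemma IsTrilin.sweedlerSum_left_comm (hco : Cocomm k H) {f : H → H → H → P}
    (hf : IsTrilin k f) (h : H) :
    (sweedlerSum k h fun a b => sweedlerSum k b fun c d => f a c d) =
      sweedlerSum k h fun a b => sweedlerSum k b fun c d => f c a d := by
  have hf' : IsTrilin k fun a b c => f b a c :=
    ⟨fun b c => hf.snd b c, fun a c => hf.fst a c, fun a b => hf.thd b a⟩
  rw [← hf.sweedlerSum_assoc, ← hf'.sweedlerSum_assoc]
  refine sweedlerSum_congr fun a b => ?_
  exact (IsBilin.sweedlerSum_flip hco ⟨fun d => hf.fst d b, fun c => hf.snd c b⟩ a).symm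

lemma IsBilin.sweedlerSum_mul {f : H → H → P} (hf : IsBilin k f) (h l : H) :
    sweedlerSum k (h * l) f =
      sweedlerSum k h fun a b => sweedlerSum k l fun c d => f (a * c) (b * d) := by
  rw [hf.sweedlerSum_eq, Bialgebra.comul_mul, ← (ℛ k h).eq, ← (ℛ k l).eq, Finset.sum_mul_sum]
  simp [sweedlerSum]

lemma IsBilin.sweedlerSum_one {f : H → H → P} (hf : IsBilin k f) :
    sweedlerSum k (1 : H) f = f 1 1 := by
  rw [hf.sweedlerSum_eq, Bialgebra.comul_one, Algebra.TensorProduct.one_def]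
  simp

lemma sweedlerSum_counit_smul (h : H) :
    (sweedlerSum k h fun a b => counit (R := k) a • b) = h :=
  sum_counit_smul (ℛ k h)

lemma isTrilin_sweedlerSum_fun {f : H → H → H → H → H → H → P}
    (hf : ∀ x y z, IsTrilin k fun a b c => f a b c x y z) (l : H) :
    IsTrilin k fun a b c => sweedlerSum k l fun x y => sweedlerSum k y (f a b c x) :=
  ⟨fun b c => isLinearMap_sweedlerSum_fun l fun _ _ => isLinearMap_sweedlerSum_fun _ fun _ _ =>
      (hf _ _ _).fst b c,
    fun a c => isLinearMap_sweedlerSum_fun l fun _ _ => isLinearMap_sweedlerSum_fun _ fun _ _ =>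
      (hf _ _ _).snd a c,
    fun a b => isLinearMap_sweedlerSum_fun l fun _ _ => isLinearMap_sweedlerSum_fun _ fun _ _ =>
      (hf _ _ _).thd a b⟩

lemma sweedlerSum_assoc₂ {f : H → H → H → H → H → H → P}
    (hf : ∀ x y z, IsTrilin k fun a b c => f a b c x y z) (hf' : ∀ a b c, IsTrilin k (f a b c))
    (h l : H) :
    (sweedlerSum k h fun a b => sweedlerSum k l fun c d =>
      sweedlerSum k b fun b₁ b₂ => sweedlerSum k d fun d₁ d₂ => f a b₁ b₂ c d₁ d₂) =
    sweedlerSum k h fun a b => sweedlerSum k l fun c d =>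
      sweedlerSum k a fun a₁ a₂ => sweedlerSum k c fun c₁ c₂ => f a₁ a₂ b c₁ c₂ d := by
  have hg := isTrilin_sweedlerSum_fun hf l
  calc
    _ = sweedlerSum k h fun a b => sweedlerSum k b fun b₁ b₂ => sweedlerSum k l fun c d =>
          sweedlerSum k d (f a b₁ b₂ c) :=
      sweedlerSum_congr fun a b => sweedlerSum_comm l b _
    _ = sweedlerSum k h fun a b => sweedlerSum k a fun a₁ a₂ => sweedlerSum k l fun c d =>
          sweedlerSum k d (f a₁ a₂ b c) := (hg.sweedlerSum_assoc h).symm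
    _ = sweedlerSum k h fun a b => sweedlerSum k a fun a₁ a₂ => sweedlerSum k l fun c d =>
          sweedlerSum k c fun c₁ c₂ => f a₁ a₂ b c₁ c₂ d :=
      sweedlerSum_congr fun a b => sweedlerSum_congr fun a₁ a₂ =>
        ((hf' a₁ a₂ b).sweedlerSum_assoc l).symm
    _ = _ := sweedlerSum_congr fun a b => sweedlerSum_comm a l _

lemma sweedlerSum_left_comm₂ (hco : Cocomm k H) {f : H → H → H → H → H → H → P}
    (hf : ∀ x y z, IsTrilin k fun a b c => f a b c x y z) (hf' : ∀ a b c, IsTrilin k (f a b c))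
    (h l : H) :
    (sweedlerSum k h fun a b => sweedlerSum k l fun c d =>
      sweedlerSum k b fun b₁ b₂ => sweedlerSum k d fun d₁ d₂ => f a b₁ b₂ c d₁ d₂) =
    sweedlerSum k h fun a b => sweedlerSum k l fun c d =>
      sweedlerSum k b fun b₁ b₂ => sweedlerSum k d fun d₁ d₂ => f b₁ a b₂ d₁ c d₂ := by
  have hg := isTrilin_sweedlerSum_fun hf l
  calc
    _ = sweedlerSum k h fun a b => sweedlerSum k b fun b₁ b₂ => sweedlerSum k l fun c d =>
          sweedlerSum k d (f a b₁ b₂ c) :=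
      sweedlerSum_congr fun a b => sweedlerSum_comm l b _
    _ = sweedlerSum k h fun a b => sweedlerSum k b fun b₁ b₂ => sweedlerSum k l fun c d =>
          sweedlerSum k d (f b₁ a b₂ c) := hg.sweedlerSum_left_comm hco h
    _ = sweedlerSum k h fun a b => sweedlerSum k b fun b₁ b₂ => sweedlerSum k l fun c d =>
          sweedlerSum k d fun d₁ d₂ => f b₁ a b₂ d₁ c d₂ :=
      sweedlerSum_congr fun a b => sweedlerSum_congr fun b₁ b₂ =>
        (hf' b₁ a b₂).sweedlerSum_left_comm hco l
    _ = _ := sweedlerSum_congr fun a b => sweedlerSum_comm b l _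

end SweedlerSums

section TwistedMultiplication

open Coalgebra

variable {k H} {sg mu} {P : Type} [AddCommGroup P] [Module k P]

lemma IsTwistMul.eq_sweedlerSum (hmu : IsTwistMul k H sg mu) (h l : H) :
    mu h l = sweedlerSum k h fun a b => sweedlerSum k l fun c d => sg a c • (b * d) :=
  hmu h l (.ofRepr k h) (.ofRepr k l)

lemma IsTwistMul.map_eq (hmu : IsTwistMul k H sg mu) (T : H →ₗ[k] P) (h l : H) :
    T (mu h l) = sweedlerSum k h fun a b => sweedlerSum k l fun c d => sg a c • T (b * d) := by
  simp only [hmu.eq_sweedlerSum, map_sweedlerSum, map_smul]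

lemma IsTwistMul.one_left (hmu : IsTwistMul k H sg mu) (hnorm : NormalK k H sg) (h : H) :
    mu 1 h = h := by
  rw [hmu.eq_sweedlerSum, IsBilin.sweedlerSum_one]
  · simp only [(hnorm _).2, one_mul, sweedlerSum_counit_smul]
  · constructor <;> intro _ <;> apply isLinearMap_sweedlerSum_fun <;> intros <;> constructor <;>
      intros <;> simp [add_smul, add_mul, smul_smul, mul_comm]

lemma IsTwistMul.one_right (hmu : IsTwistMul k H sg mu) (hnorm : NormalK k H sg) (h : H) :
    mu h 1 = h := by
  rw [hmu.eq_sweedlerSum, sweedlerSum_comm, IsBilin.sweedlerSum_one]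
  · simp only [(hnorm _).1, mul_one, sweedlerSum_counit_smul]
  · constructor <;> intro _ <;> apply isLinearMap_sweedlerSum_fun <;> intros <;> constructor <;>
      intros <;> simp [add_smul, mul_add, smul_smul, mul_comm]

lemma CocycleK.sweedlerSum_eq (hcoc : CocycleK k H sg) (h l m : H) :
    (sweedlerSum k h fun a b => sweedlerSum k l fun c d => sg a c * sg (b * d) m) =
      sweedlerSum k l fun a b => sweedlerSum k m fun c d => sg a c * sg h (b * d) :=
  (hcoc h l m (.ofRepr k h) (.ofRepr k l) (.ofRepr k m)).symm

lemma IsTwistMul.assoc (hmu : IsTwistMul k H sg mu) (hcoc : CocycleK k H sg) (h l m : H) :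
    mu (mu h l) m = mu h (mu l m) := by
  have e₁ : ∀ b d : H, mu (b * d) m = sweedlerSum k b fun b₁ b₂ => sweedlerSum k d fun d₁ d₂ =>
      sweedlerSum k m fun x y => sg (b₁ * d₁) x • (b₂ * d₂ * y) := by
    intro b d
    rw [hmu.eq_sweedlerSum, IsBilin.sweedlerSum_mul]
    constructor <;> intro _ <;> apply isLinearMap_sweedlerSum_fun <;> intros <;> constructor <;>
      intros <;> simp [add_smul, add_mul, smul_smul, mul_comm]
  have e₂ : ∀ d y : H, mu h (d * y) = sweedlerSum k h fun a b => sweedlerSum k d fun d₁ d₂ =>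
      sweedlerSum k y fun y₁ y₂ => sg a (d₁ * y₁) • (b * (d₂ * y₂)) := by
    intro d y
    rw [hmu.eq_sweedlerSum]
    refine sweedlerSum_congr fun a b => ?_
    rw [IsBilin.sweedlerSum_mul]
    constructor <;> intro _ <;> constructor <;>
      intros <;> simp [add_smul, mul_add, smul_smul, mul_comm]
  calc
    mu (mu h l) m
      = sweedlerSum k h fun a b => sweedlerSum k l fun c d => sweedlerSum k b fun b₁ b₂ =>
          sweedlerSum k d fun d₁ d₂ => sweedlerSum k m fun x y =>
            sg a c • sg (b₁ * d₁) x • (b₂ * d₂ * y) := by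
      rw [← LinearMap.flip_apply, hmu.map_eq]
      simp only [LinearMap.flip_apply, e₁, sweedlerSum_smul_fun]
    _ = sweedlerSum k h fun a b => sweedlerSum k l fun c d => sweedlerSum k a fun a₁ a₂ =>
          sweedlerSum k c fun c₁ c₂ => sweedlerSum k m fun x y =>
            sg a₁ c₁ • sg (a₂ * c₂) x • (b * d * y) := by
      apply sweedlerSum_assoc₂ (f := fun a b₁ b₂ c d₁ d₂ => sweedlerSum k m fun x y =>
            sg a c • sg (b₁ * d₁) x • (b₂ * d₂ * y)) <;> intros <;> constructor <;> intro _ _ <;>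
        apply isLinearMap_sweedlerSum_fun <;> intros <;> constructor <;>
        intros <;> simp [add_smul, mul_add, add_mul, smul_smul, mul_left_comm, mul_comm]
    _ = sweedlerSum k h fun a b => sweedlerSum k l fun c d => sweedlerSum k m fun x y =>
          sweedlerSum k a fun a₁ a₂ => sweedlerSum k c fun c₁ c₂ =>
            sg a₁ c₁ • sg (a₂ * c₂) x • (b * d * y) := by
      refine sweedlerSum_congr fun a b => sweedlerSum_congr fun c d => ?_
      rw [sweedlerSum_comm m]
      exact sweedlerSum_congr fun _ _ => sweedlerSum_comm _ _ _
    _ = sweedlerSum k h fun a b => sweedlerSum k l fun c d => sweedlerSum k m fun x y =>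
          sweedlerSum k c fun c₁ c₂ => sweedlerSum k x fun x₁ x₂ =>
            sg c₁ x₁ • sg a (c₂ * x₂) • (b * (d * y)) := by
      refine sweedlerSum_congr fun a b => sweedlerSum_congr fun c d =>
        sweedlerSum_congr fun x y => ?_
      have := congrArg (LinearMap.toSpanSingleton k H (b * d * y)) (hcoc.sweedlerSum_eq a c x)
      simpa only [map_sweedlerSum, LinearMap.toSpanSingleton_apply, mul_smul, mul_assoc] using this
    _ = sweedlerSum k h fun a b => sweedlerSum k l fun c d => sweedlerSum k m fun x y =>
          sweedlerSum k d fun d₁ d₂ => sweedlerSum k y fun y₁ y₂ =>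
            sg c x • sg a (d₁ * y₁) • (b * (d₂ * y₂)) := by
      refine sweedlerSum_congr fun a b => Eq.symm ?_
      apply sweedlerSum_assoc₂ (f := fun c d₁ d₂ x y₁ y₂ =>
        sg c x • sg a (d₁ * y₁) • (b * (d₂ * y₂))) <;> intros <;> constructor <;> intro _ _ <;>
        constructor <;> intros <;>
        simp [add_smul, mul_add, add_mul, smul_smul, mul_left_comm, mul_comm]
    _ = mu h (mu l m) := by
      rw [hmu.map_eq, sweedlerSum_comm]
      simp only [e₂, ← sweedlerSum_smul_fun]
      refine sweedlerSum_congr fun c d => ?_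
      rw [sweedlerSum_comm]

lemma IsTwistMul.sweedlerSum_eq (hmu : IsTwistMul k H sg mu) (hco : Cocomm k H)
    {f : H → H → P} (hf : IsBilin k f) (h l : H) :
    sweedlerSum k (mu h l) f =
      sweedlerSum k h fun a b => sweedlerSum k l fun c d => f (a * c) (mu b d) := by
  calc
    _ = sweedlerSum k h fun a b => sweedlerSum k l fun c d => sweedlerSum k b fun b₁ b₂ =>
          sweedlerSum k d fun d₁ d₂ => sg a c • f (b₁ * d₁) (b₂ * d₂) := by
      have := hmu.map_eq hf.isLinearMap_sweedlerSum.mk' h l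
      simpa only [IsLinearMap.mk'_apply, hf.sweedlerSum_mul, ← sweedlerSum_smul_fun] using this
    _ = sweedlerSum k h fun a b => sweedlerSum k l fun c d => sweedlerSum k b fun b₁ b₂ =>
          sweedlerSum k d fun d₁ d₂ => sg b₁ d₁ • f (a * c) (b₂ * d₂) := by
      simp only [← hf.toLinearMap_apply]
      apply sweedlerSum_left_comm₂ hco
        (f := fun a b₁ b₂ c d₁ d₂ => sg a c • hf.toLinearMap (b₁ * d₁) (b₂ * d₂)) <;> intros <;>
        constructor <;> intro _ _ <;> constructor <;> intros <;>
        simp [-IsBilin.toLinearMap_apply, add_smul, mul_add, add_mul, smul_smul, mul_comm]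
    _ = _ := sweedlerSum_congr fun a b => sweedlerSum_congr fun c d =>
      (hmu.map_eq (hf.toLinearMap (a * c)) b d).symm

end TwistedMultiplication

section DiagonalAction

open Coalgebra

variable {k H A} {rho} {P : Type} [AddCommGroup P] [Module k P]
  {V W : Type} [AddCommGroup V] [Module k V] [AddCommGroup W] [Module k W]

lemma tpow_succ {n : ℕ} (f : Fin (n + 2) → A) :
    tpow k A (n + 1) f = (f 0 ⊗ₜ[k] tpow k A n fun i => f i.succ : A ⊗[k] Tpow k A n) :=
  rfl

lemma linearMap_ext_tpow : ∀ {P : Type} [AddCommGroup P] [Module k P] {n : ℕ}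
    {F G : Tpow k A n →ₗ[k] P}, (∀ a, F (tpow k A n a) = G (tpow k A n a)) → F = G
  | P, _, _, 0, F, G, hFG => LinearMap.ext fun x => hFG fun _ => x
  | P, _, _, n + 1, F, G, hFG => by
    refine TensorProduct.ext (M := A) (N := Tpow k A n) (LinearMap.ext fun x => ?_)
    refine linearMap_ext_tpow fun a => ?_
    simpa only [tpow_succ, Fin.cons_zero, Fin.cons_succ] using! hFG (Fin.cons x a)

/-- The diagonal action of `H` on a tensor product: `h(v ⊗ w) = h⁽¹⁾(v) ⊗ h⁽²⁾(w)`. -/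
def tensorAct (α : H →ₗ[k] V →ₗ[k] V) (β : H →ₗ[k] W →ₗ[k] W) :
    H →ₗ[k] (V ⊗[k] W) →ₗ[k] (V ⊗[k] W) :=
  TensorProduct.homTensorHomMap (.id k) V W V W ∘ₗ TensorProduct.map α β ∘ₗ comul

lemma isBilin_tmul_apply (α : H →ₗ[k] V →ₗ[k] V) (β : H →ₗ[k] W →ₗ[k] W) (v : V) (w : W) :
    IsBilin k fun a b => α a v ⊗ₜ[k] β b w := by
  constructor <;> intro _ <;> constructor <;> intros <;>
    simp [TensorProduct.tmul_add, TensorProduct.add_tmul, TensorProduct.smul_tmul']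

lemma tensorAct_tmul (α : H →ₗ[k] V →ₗ[k] V) (β : H →ₗ[k] W →ₗ[k] W) (h : H) (v : V) (w : W) :
    tensorAct α β h (v ⊗ₜ[k] w) = sweedlerSum k h fun a b => α a v ⊗ₜ[k] β b w := by
  rw [tensorAct, LinearMap.comp_apply, LinearMap.comp_apply, ← (ℛ k h).eq]
  simp [sweedlerSum, LinearMap.sum_apply]

lemma tensorAct_one {α : H →ₗ[k] V →ₗ[k] V} {β : H →ₗ[k] W →ₗ[k] W} (hα : α 1 = .id)
    (hβ : β 1 = .id) : tensorAct α β 1 = .id := by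
  refine TensorProduct.ext' fun v w => ?_
  rw [tensorAct_tmul, (isBilin_tmul_apply α β v w).sweedlerSum_one, hα, hβ]
  rfl

lemma tensorAct_mul {α : H →ₗ[k] V →ₗ[k] V} {β : H →ₗ[k] W →ₗ[k] W}
    (hα : ∀ h l, α (h * l) = α h ∘ₗ α l) (hβ : ∀ h l, β (h * l) = β h ∘ₗ β l) (h l : H) :
    tensorAct α β (h * l) = tensorAct α β h ∘ₗ tensorAct α β l := by
  refine TensorProduct.ext' fun v w => ?_
  rw [LinearMap.comp_apply, tensorAct_tmul, tensorAct_tmul,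
    (isBilin_tmul_apply α β v w).sweedlerSum_mul, map_sweedlerSum, sweedlerSum_comm]
  simp only [tensorAct_tmul, hα, hβ, LinearMap.comp_apply]

/-- The diagonal action of `H` on the tensor powers of `A`:
`h(a₀ ⊗ ⋯ ⊗ aₙ) = h⁽¹⁾(a₀) ⊗ ⋯ ⊗ h⁽ⁿ⁺¹⁾(aₙ)`. -/
def diagAct (rho : H →ₗ[k] A →ₗ[k] A) : (n : ℕ) → H →ₗ[k] Tpow k A n →ₗ[k] Tpow k A n
  | 0 => rho
  | n + 1 => tensorAct rho (diagAct rho n)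

lemma diagAct_one (hone : rho 1 = .id) : ∀ n : ℕ, diagAct rho n 1 = .id
  | 0 => hone
  | n + 1 => tensorAct_one hone (diagAct_one hone n)

lemma diagAct_mul (hmul : ∀ h l : H, rho (h * l) = rho h ∘ₗ rho l) :
    ∀ (n : ℕ) (h l : H), diagAct rho n (h * l) = diagAct rho n h ∘ₗ diagAct rho n l
  | 0 => hmul
  | n + 1 => tensorAct_mul hmul (diagAct_mul hmul n)

lemma sweedlerSum_tmul_tensorAct (F : H →ₗ[k] H →ₗ[k] P) (α : H →ₗ[k] V →ₗ[k] V)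
    (β : H →ₗ[k] W →ₗ[k] W) (h : H) (v : V) (w : W) :
    (sweedlerSum k h fun x y => sweedlerSum k y (fun u v => F u v) ⊗ₜ[k]
      tensorAct α β x (v ⊗ₜ[k] w)) =
    sweedlerSum k h fun x y => LinearMap.lTensor P (TensorProduct.mk k V W (α x v))
      (sweedlerSum k y fun y z => sweedlerSum k z (fun u v => F u v) ⊗ₜ[k] β y w) := by
  have hf : IsTrilin k fun x y z : H =>
      sweedlerSum k z (fun u v => F u v) ⊗ₜ[k] (α x v ⊗ₜ[k] β y w) := by
    simp only [sweedlerSum_eq_lift]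
    constructor <;> intro _ _ <;> constructor <;> intros <;>
      simp [TensorProduct.tmul_add, TensorProduct.add_tmul, ← TensorProduct.smul_tmul']
  simp only [map_sweedlerSum, LinearMap.lTensor_tmul, TensorProduct.mk_apply]
  rw [← hf.sweedlerSum_assoc]
  refine sweedlerSum_congr fun x y => ?_
  rw [tensorAct_tmul]
  exact map_sweedlerSum (TensorProduct.mk k P (V ⊗[k] W) _) _ _

/-- A representation of `Δ⁽ⁿ⁺¹⁾(h)` built from representations of `Δ⁽ⁿ⁾(h⁽²⁾)`. -/
def IterRepr.cons {n : ℕ} (h : H) (R : ∀ x : H, IterRepr k H n x) : IterRepr k H (n + 1) h where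
  ι := Σ i : H × H, (R i.2).ι
  s := (ℛ k h).index.sigma fun i => (R i.2).s
  leg i := Fin.cons i.1.1 ((R i.1.2).leg i.2)
  eq := by
    have e : comulIter k H (n + 1) h =
      (LinearMap.lTensor H (comulIter k H n) (comul h) : H ⊗[k] Tpow k H n) := rfl
    rw [e, ← (ℛ k h).eq, Finset.sum_sigma, map_sum]
    refine Finset.sum_congr rfl fun i _ => ?_
    rw [LinearMap.lTensor_tmul, ← (R _).eq, TensorProduct.tmul_sum]
    rfl

lemma IterRepr.sum_cons {n : ℕ} (h : H) (R : ∀ x : H, IterRepr k H n x)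
    {M : Type} [AddCommGroup M] (F : (Fin (n + 2) → H) → M) :
    ∑ i ∈ (IterRepr.cons h R).s, F ((IterRepr.cons h R).leg i) =
      sweedlerSum k h fun a b => ∑ j ∈ (R b).s, F (Fin.cons a ((R b).leg j)) :=
  Finset.sum_sigma _ _ _

lemma exists_iterRepr_sum_eq_diagAct (q : ℕ) (h : H) :
    ∃ R : IterRepr k H (q + 2) h, ∀ (F : H →ₗ[k] H →ₗ[k] P) (a : Fin (q + 1) → A),
      ∑ i ∈ R.s, F (R.leg i ⟨q + 1, by omega⟩) (R.leg i (Fin.last (q + 2))) ⊗ₜ[k]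
        tpow k A q (fun c => rho (R.leg i (Fin.castLE (by omega) c)) (a c)) =
      sweedlerSum k h fun x y => sweedlerSum k y (fun u v => F u v) ⊗ₜ[k]
        diagAct rho q x (tpow k A q a) := by
  induction q generalizing h with
  | zero =>
    refine ⟨.cons h fun x => .ofRepr k x, fun F a => ?_⟩
    refine (IterRepr.sum_cons h _ fun f => F (f 1) (f 2) ⊗ₜ[k]
      tpow k A 0 fun c => rho (f 0) (a c)).trans ?_
    refine sweedlerSum_congr fun x y => ?_
    rw [sweedlerSum, TensorProduct.sum_tmul]
    rfl
  | succ q ih =>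
    choose R hR using ih
    refine ⟨.cons h R, fun F a => ?_⟩
    refine (IterRepr.sum_cons h R fun f => F (f ⟨q + 2, by omega⟩) (f (Fin.last (q + 3))) ⊗ₜ[k]
      tpow k A (q + 1) fun c => rho (f (Fin.castLE (by omega) c)) (a c)).trans ?_
    refine Eq.trans (sweedlerSum_congr fun x y => ?_) (sweedlerSum_tmul_tensorAct F rho
      (diagAct rho q) h (a 0) (tpow k A q fun i => a i.succ)).symm
    rw [← hR, map_sum]
    rfl

end DiagonalAction

section BimoduleActions

open Coalgebra

variable {k H A} {rho sg mu q}
  {L Rt : H →ₗ[k] (H ⊗[k] (Tpow k A q : Type)) →ₗ[k] (H ⊗[k] (Tpow k A q : Type))}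

lemma IsLeftActMq.apply_tmul (hL : IsLeftActMq k H A rho sg q L) (hmu : IsTwistMul k H sg mu)
    (hco : Cocomm k H) (h g : H) (t : Tpow k A q) :
    L h (g ⊗ₜ[k] t) = sweedlerSum k h fun a b => mu b g ⊗ₜ[k] diagAct rho q a t := by
  have hb : ∀ x y : H, IsBilin k fun c d => sg x c • (y * d) := by
    intro x y
    constructor <;> intro _ <;> constructor <;> intros <;>
      simp [add_smul, mul_add, smul_smul, mul_comm]
  have hg : IsLinearMap k fun t : Tpow k A q =>
      sweedlerSum k h fun a b => mu b g ⊗ₜ[k] diagAct rho q a t :=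
    isLinearMap_sweedlerSum_fun h fun a b =>
      (TensorProduct.mk k H (Tpow k A q) (mu b g) ∘ₗ diagAct rho q a).isLinear
  refine LinearMap.congr_fun (f := L h ∘ₗ TensorProduct.mk k H (Tpow k A q) g) (g := hg.mk')
    (linearMap_ext_tpow fun a => ?_) t
  obtain ⟨R, hR⟩ := exists_iterRepr_sum_eq_diagAct (rho := rho) (A := A) (P := H) q h
  have hF : IsBilin k fun u v : H => sweedlerSum k g fun c d => sg v d • (u * c) := by
    constructor <;> intro _ <;> apply isLinearMap_sweedlerSum_fun <;> intros <;> constructor <;>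
      intros <;> simp [add_smul, add_mul, smul_smul, mul_comm]
  rw [LinearMap.comp_apply, TensorProduct.mk_apply, hL h g a R (.ofRepr k g), hg.mk'_apply]
  calc
    _ = sweedlerSum k h fun x y => sweedlerSum k y (fun u v => hF.toLinearMap u v) ⊗ₜ[k]
          diagAct rho q x (tpow k A q a) := by
      rw [← hR]
      refine Finset.sum_congr rfl fun i _ => ?_
      rw [hF.toLinearMap_apply, sweedlerSum, TensorProduct.sum_tmul]
      rfl
    _ = _ := by
      refine sweedlerSum_congr fun x y => ?_
      simp only [hF.toLinearMap_apply]
      rw [hmu.eq_sweedlerSum, ← hF.sweedlerSum_flip hco]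
      refine congrArg (· ⊗ₜ[k] _) (sweedlerSum_congr fun u v => ?_)
      exact (hb u v).sweedlerSum_flip hco g

lemma IsRightActMq.apply_tmul (hRt : IsRightActMq k H A sg q Rt) (hmu : IsTwistMul k H sg mu)
    (hco : Cocomm k H) (h g : H) (t : Tpow k A q) :
    Rt h (g ⊗ₜ[k] t) = mu g h ⊗ₜ[k] t := by
  refine LinearMap.congr_fun (f := Rt h ∘ₗ TensorProduct.mk k H (Tpow k A q) g)
    (g := TensorProduct.mk k H (Tpow k A q) (mu g h)) (linearMap_ext_tpow fun a => ?_) t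
  have hf : IsBilin k fun u v : H => sweedlerSum k h fun c d => sg u c • (v * d) := by
    constructor <;> intro _ <;> apply isLinearMap_sweedlerSum_fun <;> intros <;> constructor <;>
      intros <;> simp [add_smul, add_mul, smul_smul, mul_comm]
  have hb : ∀ x y : H, IsBilin k fun c d => sg x c • (y * d) := by
    intro x y
    constructor <;> intro _ <;> constructor <;> intros <;>
      simp [add_smul, mul_add, smul_smul, mul_comm]
  rw [LinearMap.comp_apply, TensorProduct.mk_apply, hRt h g a (.ofRepr k g) (.ofRepr k h),
    TensorProduct.mk_apply, hmu.eq_sweedlerSum, ← hf.sweedlerSum_flip hco]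
  have e : ∀ u v : H, (sweedlerSum k h fun c d => sg v c • (u * d)) =
      sweedlerSum k h fun c d => sg v d • (u * c) := fun u v =>
    ((hb v u).sweedlerSum_flip hco h).symm
  simp only [e]
  simp only [sweedlerSum, TensorProduct.sum_tmul]
  rfl

end BimoduleActions

/-- Under the standing assumptions (with `σ` `k`-valued), the displayed
formulas define an `H_σ`-bimodule structure on `M_q = H ⊗ A^{⊗(q+1)}`: the left formula is a
left `H_σ`-module structure, the right formula a right `H_σ`-module structure, and the two
actions commute. -/
theorem Mq_is_sigma_bimodule
    (k : Type) [Field k] (H : Type) [Ring H] [HopfAlgebra k H]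
    (A : Type) [Ring A] [Algebra k A]
    (rho : H →ₗ[k] A →ₗ[k] A) (sg : H →ₗ[k] H →ₗ[k] k)
    (hco : Cocomm k H) (hma : IsModuleAlgebraAction k H A rho)
    (hnorm : NormalK k H sg) (hcoc : CocycleK k H sg)
    (hinv : ∃ sg' : H →ₗ[k] H →ₗ[k] k, IsConvInvPair k H sg sg')
    (mu : H →ₗ[k] H →ₗ[k] H) (hmu : IsTwistMul k H sg mu)
    (q : ℕ)
    (L Rt : H →ₗ[k] (H ⊗[k] (Tpow k A q : Type)) →ₗ[k] (H ⊗[k] (Tpow k A q : Type)))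
    (hL : IsLeftActMq k H A rho sg q L)
    (hRt : IsRightActMq k H A sg q Rt) :
    (∀ (h h' : H) (x : H ⊗[k] (Tpow k A q : Type)), L h (L h' x) = L (mu h h') x) ∧
    (∀ x : H ⊗[k] (Tpow k A q : Type), L 1 x = x) ∧
    (∀ (h h' : H) (x : H ⊗[k] (Tpow k A q : Type)), Rt h' (Rt h x) = Rt (mu h h') x) ∧
    (∀ x : H ⊗[k] (Tpow k A q : Type), Rt 1 x = x) ∧
    (∀ (h h' : H) (x : H ⊗[k] (Tpow k A q : Type)), L h (Rt h' x) = Rt h' (L h x)) := by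
  obtain ⟨⟨-, -, hone⟩, hmul⟩ := hma
  have ext {F G : H ⊗[k] (Tpow k A q : Type) →ₗ[k] H ⊗[k] (Tpow k A q : Type)}
      (hFG : ∀ g t, F (g ⊗ₜ[k] t) = G (g ⊗ₜ[k] t)) (x) : F x = G x :=
    LinearMap.congr_fun (TensorProduct.ext' hFG) x
  have hl := hL.apply_tmul hmu hco
  have hr := hRt.apply_tmul hmu hco
  have hact : ∀ h l t, diagAct rho q (h * l) t = diagAct rho q h (diagAct rho q l t) :=
    fun h l => LinearMap.congr_fun (diagAct_mul (fun h l => LinearMap.ext (hmul h l)) q h l)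
  have hb (g : H) (t : Tpow k A q) : IsBilin k fun a b => mu b g ⊗ₜ[k] diagAct rho q a t := by
    constructor <;> intro _ <;> constructor <;> intros <;>
      simp [TensorProduct.tmul_add, TensorProduct.add_tmul, TensorProduct.smul_tmul']
  refine ⟨fun h h' => ext (F := L h ∘ₗ L h') fun g t => ?_,
    ext (G := .id) fun g t => ?_,
    fun h h' => ext (F := Rt h' ∘ₗ Rt h) fun g t => ?_,
    ext (G := .id) fun g t => ?_,
    fun h h' => ext (F := L h ∘ₗ Rt h') (G := Rt h' ∘ₗ L h) fun g t => ?_⟩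
  · rw [LinearMap.comp_apply, hl, hl, map_sweedlerSum, hmu.sweedlerSum_eq hco (hb g t),
      sweedlerSum_comm]
    simp only [hl, hact, hmu.assoc hcoc]
  · rw [hl, (hb g t).sweedlerSum_one, hmu.one_left hnorm, diagAct_one (LinearMap.ext hone)]
    rfl
  · simp only [LinearMap.comp_apply, hr, hmu.assoc hcoc]
  · rw [hr, hmu.one_right hnorm, LinearMap.id_apply]
  · simp only [LinearMap.comp_apply, hl, hr, map_sweedlerSum, hmu.assoc hcoc]
end
end

section
/- (Mac Lane isomorphism for Hopf crossed products.) Let H be a cocommutative Hopf algebra over a field k, σ : H⊗H → k a convolution invertible, normal 2-cocycle, H_σ = k#_σH, and M an H_σ-bimodule, with M̃ the left H-module given by h▶m = σ⁻¹(S(h⁽²⁾),h⁽³⁾)·(overline{h⁽⁴⁾} m overline{S(h⁽¹⁾)}). Then for every n ≥ 0 the map Θ : H_σ^{⊗n}⊗M → H^{⊗n}⊗M̃, Θ(overline{h_1}⊗⋯⊗overline{h_n}⊗m) = h_1⁽²⁾⊗⋯⊗h_n⁽²⁾⊗ m·overline{h_1⁽¹⁾}⋯overline{h_n⁽¹⁾},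 is an isomorphism of simplicial k-modules from the Hochschild complex C_•(H_σ,M) to the Hopf homology complex C_•(H;M̃); in particular Θ commutes with all face and degeneracy operators and is bijective. -/
open TensorProduct

noncomputable section

variable (k : Type) [Field k] (H : Type) [Ring H] [HopfAlgebra k H]

variable (A : Type) [Ring A] [Algebra k A]
variable (rho : H →ₗ[k] A →ₗ[k] A)

variable (sg : H →ₗ[k] H →ₗ[k] k)

/-! ## The twisted algebra `H_σ = k #_σ H` and `H_σ`-bimodules -/

variable (M : Type) [AddCommGroup M] [Module k M]
variable (mu : H →ₗ[k] H →ₗ[k] H) (sg' : H →ₗ[k] H →ₗ[k] k)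
variable (lact ract : H →ₗ[k] M →ₗ[k] M)

namespace MacLane

open Coalgebra HopfAlgebra WithConv LinearMap

section Hopf

variable {k H}

/-- The Sweedler representation of `Δ h` given by a `Coalgebra.Repr`. -/
def iterReprOfRepr {h : H} {ι : Type} (R : Coalgebra.Repr k h ι) : IterRepr k H 1 h where
  ι := ι
  s := R.index
  leg i := ![R.left i, R.right i]
  eq := by
    change ∑ i ∈ R.index, R.left i ⊗ₜ[k] R.right i = lTensor H LinearMap.id (comul h)
    rw [R.eq, lTensor_id, id_apply]

theorem convMul_of_isTwistMul {sg : H →ₗ[k] H →ₗ[k] k} {mu : H →ₗ[k] H →ₗ[k] H}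
    (hmu : IsTwistMul k H sg mu) :
    toConv (TensorProduct.lift mu) =
      toConv (Algebra.linearMap k H ∘ₗ TensorProduct.lift sg) * toConv (mul' k H) := by
  ext h g
  have := hmu h g (iterReprOfRepr (ℛ k h)) (iterReprOfRepr (ℛ k g))
  simp only [TensorProduct.AlgebraTensorModule.curry_apply, TensorProduct.curry_apply,
    coe_restrictScalars, TensorProduct.lift.tmul]
  rw [((ℛ k h).tmul (ℛ k g)).convMul_apply, this]
  simp [Coalgebra.Repr.tmul, Finset.sum_product, iterReprOfRepr, Algebra.smul_def]

theorem convMul_eq_one_of_isConvInvPair {sg sg' : H →ₗ[k] H →ₗ[k] k}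
    (hconv : IsConvInvPair k H sg sg') :
    toConv (TensorProduct.lift sg) * toConv (TensorProduct.lift sg') = 1 := by
  ext h g
  have := (hconv h g (iterReprOfRepr (ℛ k h)) (iterReprOfRepr (ℛ k g))).1
  simp only [TensorProduct.AlgebraTensorModule.curry_apply, TensorProduct.curry_apply,
    coe_restrictScalars]
  rw [((ℛ k h).tmul (ℛ k g)).convMul_apply]
  simpa [Coalgebra.Repr.tmul, Finset.sum_product, iterReprOfRepr, mul_comm] using this

theorem convMul_eq_of_cocycleK {sg : H →ₗ[k] H →ₗ[k] k} (hcoc : CocycleK k H sg) :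
    toConv ((TensorProduct.lid k k).toLinearMap ∘ₗ
        TensorProduct.map counit (TensorProduct.lift sg)) *
      toConv (TensorProduct.lift sg ∘ₗ TensorProduct.map LinearMap.id (mul' k H)) =
    toConv ((TensorProduct.rid k k).toLinearMap ∘ₗ
        TensorProduct.map (TensorProduct.lift sg) counit ∘ₗ
          (TensorProduct.assoc k H H H).symm.toLinearMap) *
      toConv (TensorProduct.lift sg ∘ₗ TensorProduct.map (mul' k H) LinearMap.id ∘ₗ
        (TensorProduct.assoc k H H H).symm.toLinearMap) := by
  ext h l m
  have := hcoc h l m (iterReprOfRepr (ℛ k h)) (iterReprOfRepr (ℛ k l)) (iterReprOfRepr (ℛ k m))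
  simp only [TensorProduct.AlgebraTensorModule.curry_apply, TensorProduct.curry_apply,
    coe_restrictScalars]
  rw [((ℛ k h).tmul ((ℛ k l).tmul (ℛ k m))).convMul_apply,
    ((ℛ k h).tmul ((ℛ k l).tmul (ℛ k m))).convMul_apply]
  have eh (x : H) : sg h x =
      ∑ i ∈ (ℛ k h).index, counit (R := k) ((ℛ k h).left i) * sg ((ℛ k h).right i) x := by
    conv_lhs => rw [← sum_counit_smul (ℛ k h)]
    simp
  have em (x : H) : sg x m =
      ∑ i ∈ (ℛ k m).index, counit (R := k) ((ℛ k m).left i) * sg x ((ℛ k m).right i) := by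
    conv_lhs => rw [← sum_counit_smul (ℛ k m)]
    simp
  simp only [iterReprOfRepr, eh, em, Finset.mul_sum, Matrix.cons_val_zero, Matrix.cons_val_one]
    at this
  simp only [Coalgebra.Repr.tmul, Finset.sum_product, LinearMap.comp_apply, TensorProduct.map_tmul,
    LinearEquiv.coe_coe, TensorProduct.lid_tmul, TensorProduct.rid_tmul, TensorProduct.lift.tmul,
    TensorProduct.assoc_symm_tmul, mul'_apply, LinearMap.id_apply, smul_eq_mul]
  convert this using 1
  · rw [Finset.sum_comm]
    refine Finset.sum_congr rfl fun _ _ => ?_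
    rw [Finset.sum_comm]
    refine Finset.sum_congr rfl fun _ _ => Finset.sum_congr rfl fun _ _ => ?_
    ring
  · refine Finset.sum_congr rfl fun _ _ => Finset.sum_congr rfl fun _ _ =>
      Finset.sum_congr rfl fun _ _ => ?_
    ring

theorem convOne_comp_coalgHom {C D A : Type} [AddCommGroup C] [Module k C] [Coalgebra k C]
    [AddCommGroup D] [Module k D] [Coalgebra k D] [Ring A] [Algebra k A] (f : C →ₗc[k] D) :
    (1 : WithConv (D →ₗ[k] A)).ofConv ∘ₗ f.toLinearMap = (1 : WithConv (C →ₗ[k] A)).ofConv := by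
  ext
  simp [LinearMap.convOne_def]

/-- The antipode of a cocommutative Hopf algebra is a coalgebra map. -/
def antipodeCoalgHom [IsCocomm k H] : H →ₗc[k] H where
  __ := antipode k (A := H)
  counit_comp := by ext; simp
  map_comp_comul := by
    have hl : toConv ((comul : H →ₗ[k] H ⊗[k] H) ∘ₗ antipode k) * toConv comul = 1 := by
      have := algHom_comp_convMul_distrib (Bialgebra.comulAlgHom k H)
        (toConv (antipode k (A := H))) (toConv LinearMap.id)
      rw [antipode_mul_id] at this
      refine (congrArg toConv this).symm.trans ?_
      ext x
      simp [Algebra.TensorProduct.one_def,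
        Algebra.algebraMap_eq_smul_one, TensorProduct.smul_tmul']
    have hr : toConv (comul : H →ₗ[k] H ⊗[k] H) *
        toConv (TensorProduct.map (antipode k) (antipode k) ∘ₗ comul) = 1 := by
      have := convMul_comp_coalgHom_distrib (toConv (TensorProduct.map LinearMap.id LinearMap.id))
        (toConv (TensorProduct.map (antipode k (A := H)) (antipode k (A := H)))) (comulCoalgHom k H)
      have hm := TensorProduct.map_convMul_map (f := toConv (LinearMap.id (R := k) (M := H)))
        (g := toConv (LinearMap.id (R := k) (M := H))) (h := toConv (antipode k (A := H)))
        (k := toConv (antipode k (A := H)))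
      rw [id_mul_antipode] at hm
      simp only at hm
      rw [hm, TensorProduct.map_id, LinearMap.id_comp] at this
      refine (congrArg toConv this).symm.trans (congrArg toConv ?_)
      have h1 : TensorProduct.map (1 : WithConv (H →ₗ[k] H)).ofConv
          (1 : WithConv (H →ₗ[k] H)).ofConv = (1 : WithConv (H ⊗[k] H →ₗ[k] H ⊗[k] H)).ofConv := by
        ext
        simp [Algebra.TensorProduct.one_def, Algebra.algebraMap_eq_smul_one,
          TensorProduct.smul_tmul', mul_smul]
      rw [h1, convOne_comp_coalgHom, LinearMap.convOne_def]
    exact (congrArg ofConv (left_inv_eq_right_inv hl hr)).symm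

variable [IsCocomm k H]

variable (k H) in
/-- The coalgebra map `h ↦ S(h⁽¹⁾) ⊗ h⁽²⁾`. -/
def antipodeTmul : H →ₗc[k] H ⊗[k] H :=
  (Coalgebra.TensorProduct.map antipodeCoalgHom (CoalgHom.id k H)).comp (comulCoalgHom k H)

variable (k H) in
/-- The coalgebra map `h ↦ h⁽¹⁾ ⊗ S(h⁽²⁾)`. -/
def tmulAntipode : H →ₗc[k] H ⊗[k] H :=
  (Coalgebra.TensorProduct.map (CoalgHom.id k H) antipodeCoalgHom).comp (comulCoalgHom k H)

theorem antipodeTmul_toLinearMap : (antipodeTmul k H).toLinearMap =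
    TensorProduct.map (antipode k) LinearMap.id ∘ₗ comul := rfl

theorem tmulAntipode_toLinearMap : (tmulAntipode k H).toLinearMap =
    TensorProduct.map LinearMap.id (antipode k) ∘ₗ comul := rfl

theorem mul'_comp_antipodeTmul : mul' k H ∘ₗ (antipodeTmul k H).toLinearMap =
    (1 : WithConv (H →ₗ[k] H)).ofConv := by
  rw [← antipode_mul_id]
  rfl

theorem mul'_comp_tmulAntipode : mul' k H ∘ₗ (tmulAntipode k H).toLinearMap =
    (1 : WithConv (H →ₗ[k] H)).ofConv := by
  rw [← id_mul_antipode]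
  rfl

theorem lift_comp_antipodeTmul {sg mu} (hmu : IsTwistMul k H sg mu) :
    TensorProduct.lift mu ∘ₗ (antipodeTmul k H).toLinearMap =
      Algebra.linearMap k H ∘ₗ TensorProduct.lift sg ∘ₗ (antipodeTmul k H).toLinearMap := by
  have := convMul_comp_coalgHom_distrib
    (toConv (Algebra.linearMap k H ∘ₗ TensorProduct.lift sg)) (toConv (mul' k H)) (antipodeTmul k H)
  rw [← convMul_of_isTwistMul hmu] at this
  simpa only [mul'_comp_antipodeTmul, toConv_ofConv, mul_one, LinearMap.comp_assoc] using this

theorem lift_comp_tmulAntipode {sg mu} (hmu : IsTwistMul k H sg mu) :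
    TensorProduct.lift mu ∘ₗ (tmulAntipode k H).toLinearMap =
      Algebra.linearMap k H ∘ₗ TensorProduct.lift sg ∘ₗ (tmulAntipode k H).toLinearMap := by
  have := convMul_comp_coalgHom_distrib
    (toConv (Algebra.linearMap k H ∘ₗ TensorProduct.lift sg)) (toConv (mul' k H)) (tmulAntipode k H)
  rw [← convMul_of_isTwistMul hmu] at this
  simpa only [mul'_comp_tmulAntipode, toConv_ofConv, mul_one, LinearMap.comp_assoc] using this

theorem convMul_antipodeTmul {sg sg' : H →ₗ[k] H →ₗ[k] k} (hconv : IsConvInvPair k H sg sg') :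
    toConv (TensorProduct.lift sg ∘ₗ (antipodeTmul k H).toLinearMap) *
      toConv (TensorProduct.lift sg' ∘ₗ (antipodeTmul k H).toLinearMap) = 1 := by
  have := convMul_comp_coalgHom_distrib (toConv (TensorProduct.lift sg))
    (toConv (TensorProduct.lift sg')) (antipodeTmul k H)
  rw [convMul_eq_one_of_isConvInvPair hconv, convOne_comp_coalgHom] at this
  exact (congrArg toConv this).symm

/-- `σ(h⁽¹⁾, S(h⁽²⁾)) = σ(S(h⁽¹⁾), h⁽²⁾)`. -/
theorem lift_comp_tmulAntipode_eq {sg : H →ₗ[k] H →ₗ[k] k} (hnorm : NormalK k H sg)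
    (hcoc : CocycleK k H sg) :
    TensorProduct.lift sg ∘ₗ (tmulAntipode k H).toLinearMap =
      TensorProduct.lift sg ∘ₗ (antipodeTmul k H).toLinearMap := by
  let Q : H →ₗc[k] H ⊗[k] (H ⊗[k] H) :=
    (Coalgebra.TensorProduct.map (CoalgHom.id k H) (antipodeTmul k H)).comp (comulCoalgHom k H)
  have hQ : Q.toLinearMap =
      TensorProduct.map LinearMap.id (antipodeTmul k H).toLinearMap ∘ₗ comul := rfl
  have hQ' : (TensorProduct.assoc k H H H).symm.toLinearMap ∘ₗ Q.toLinearMap =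
      TensorProduct.map (tmulAntipode k H).toLinearMap LinearMap.id ∘ₗ comul := by
    rw [hQ, antipodeTmul_toLinearMap, tmulAntipode_toLinearMap]
    simp only [coassoc_simps]
  have h1 := convMul_comp_coalgHom_distrib
    (toConv ((TensorProduct.lid k k).toLinearMap ∘ₗ
        TensorProduct.map counit (TensorProduct.lift sg)))
    (toConv (TensorProduct.lift sg ∘ₗ TensorProduct.map LinearMap.id (mul' k H))) Q
  have h2 := convMul_comp_coalgHom_distrib
    (toConv ((TensorProduct.rid k k).toLinearMap ∘ₗ
        TensorProduct.map (TensorProduct.lift sg) counit ∘ₗ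
          (TensorProduct.assoc k H H H).symm.toLinearMap))
    (toConv (TensorProduct.lift sg ∘ₗ TensorProduct.map (mul' k H) LinearMap.id ∘ₗ
        (TensorProduct.assoc k H H H).symm.toLinearMap)) Q
  rw [← convMul_eq_of_cocycleK hcoc, h1] at h2
  simp only [LinearMap.comp_assoc, hQ'] at h2
  have mulL (x : H) := LinearMap.congr_fun (mul'_comp_antipodeTmul (k := k) (H := H)) x
  have mulR (x : H) := LinearMap.congr_fun (mul'_comp_tmulAntipode (k := k) (H := H)) x
  simp only [LinearMap.comp_apply, convOne_apply, Algebra.algebraMap_eq_smul_one] at mulL mulR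
  have e1 : (TensorProduct.lid k k).toLinearMap ∘ₗ
      TensorProduct.map counit (TensorProduct.lift sg) ∘ₗ Q.toLinearMap =
      TensorProduct.lift sg ∘ₗ (antipodeTmul k H).toLinearMap := by
    ext x
    rw [hQ]
    have := congrArg (TensorProduct.lift sg ∘ₗ (antipodeTmul k H).toLinearMap)
      (sum_counit_smul (ℛ k x))
    rw [← this]
    simp [← (ℛ k x).eq]
  have hc (x : H) : counit (R := k) x = ∑ i ∈ (ℛ k x).index,
      counit (R := k) ((ℛ k x).left i) * counit (R := k) ((ℛ k x).right i) := by
    conv_lhs => rw [← sum_counit_smul (ℛ k x)]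
    simp
  have e2 : TensorProduct.lift sg ∘ₗ TensorProduct.map LinearMap.id (mul' k H) ∘ₗ Q.toLinearMap =
      (1 : WithConv (H →ₗ[k] k)).ofConv := by
    ext x
    rw [hQ, convOne_apply, hc]
    simp only [LinearMap.comp_apply, ← (ℛ k x).eq, map_sum, TensorProduct.map_tmul, mulL,
      LinearMap.id_apply, TensorProduct.lift.tmul, map_smul, (hnorm _).1, smul_eq_mul,
      Algebra.algebraMap_self, RingHom.id_apply, mul_comm]
  have e3 : (TensorProduct.rid k k).toLinearMap ∘ₗ
      TensorProduct.map (TensorProduct.lift sg) counit ∘ₗ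
        TensorProduct.map (tmulAntipode k H).toLinearMap LinearMap.id ∘ₗ comul =
      TensorProduct.lift sg ∘ₗ (tmulAntipode k H).toLinearMap := by
    ext x
    have := congrArg (TensorProduct.lift sg ∘ₗ (tmulAntipode k H).toLinearMap)
      (congrArg (TensorProduct.rid k H) (sum_tmul_counit_eq (ℛ k x)))
    simp only [map_sum, TensorProduct.rid_tmul, one_smul, map_smul] at this
    rw [← this]
    simp [← (ℛ k x).eq]
  have e4 : TensorProduct.lift sg ∘ₗ TensorProduct.map (mul' k H) LinearMap.id ∘ₗ
        TensorProduct.map (tmulAntipode k H).toLinearMap LinearMap.id ∘ₗ comul =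
      (1 : WithConv (H →ₗ[k] k)).ofConv := by
    ext x
    rw [convOne_apply, hc]
    simp only [LinearMap.comp_apply, ← (ℛ k x).eq, map_sum, TensorProduct.map_tmul, mulR,
      LinearMap.id_apply, TensorProduct.lift.tmul, map_smul, LinearMap.smul_apply, (hnorm _).2,
      smul_eq_mul, Algebra.algebraMap_self, RingHom.id_apply]
  simp only [e1, e2, e3, e4, toConv_ofConv, mul_one] at h2
  exact h2.symm

end Hopf

section Action

variable {k H}

/-- The representation of `Δ⁽ⁿ⁺¹⁾ h` obtained from representations of `Δ h` and of each
`Δ⁽ⁿ⁾ (h⁽²⁾)`. -/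
def iterReprSucc {n : ℕ} {h : H} {ι : Type} (R : Coalgebra.Repr k h ι)
    (R' : ∀ i, IterRepr k H n (R.right i)) : IterRepr k H (n + 1) h where
  ι := (i : ι) × (R' i).ι
  s := R.index.sigma fun i => (R' i).s
  leg i := Fin.cons (R.left i.1) ((R' i.1).leg i.2)
  eq := by
    rw [Finset.sum_sigma]
    change ∑ i ∈ R.index, ∑ j ∈ (R' i).s, R.left i ⊗ₜ[k] tpow k H n ((R' i).leg j) =
      lTensor H (comulIter k H n) (comul h)
    simp only [← TensorProduct.tmul_sum, (R' _).eq, ← R.eq, map_sum, lTensor_tmul]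

variable {X : Type} [AddCommGroup X] [Module k X]

/-- The endomorphism `h ⊗ x ↦ h⁽¹⁾ ⊗ f(h⁽²⁾) x`. -/
def twistMap (f : H →ₗ[k] Module.End k X) : H ⊗[k] X →ₗ[k] H ⊗[k] X :=
  lTensor H (TensorProduct.lift f) ∘ₗ (TensorProduct.assoc k H H X).toLinearMap ∘ₗ rTensor X comul

theorem twistMap_tmul (f : H →ₗ[k] Module.End k X) {h : H} {ι : Type} (R : Coalgebra.Repr k h ι)
    (x : X) : twistMap f (h ⊗ₜ x) = ∑ i ∈ R.index, R.left i ⊗ₜ f (R.right i) x := by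
  simp [twistMap, ← R.eq, TensorProduct.sum_tmul]

theorem twistMap_comp (f g : H →ₗ[k] Module.End k X) :
    twistMap f ∘ₗ twistMap g = twistMap (toConv f * toConv g).ofConv := by
  ext h x
  have := congrArg (lTensor H (TensorProduct.lift (LinearMap.compl₂ f (g.flip x))))
    (sum_tmul_tmul_eq (ℛ k h) (fun i => ℛ k ((ℛ k h).left i)) (fun i => ℛ k ((ℛ k h).right i)))
  simp only [map_sum, lTensor_tmul, TensorProduct.lift.tmul, compl₂_apply, flip_apply] at this
  simp only [TensorProduct.AlgebraTensorModule.curry_apply, TensorProduct.curry_apply,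
    coe_restrictScalars, LinearMap.comp_apply, twistMap_tmul _ (ℛ k _), map_sum, this,
    (ℛ k _).convMul_apply, LinearMap.sum_apply, TensorProduct.tmul_sum]
  rfl

theorem twistMap_one : twistMap (1 : WithConv (H →ₗ[k] Module.End k X)).ofConv = LinearMap.id := by
  ext h x
  have := congrArg (TensorProduct.rid k H) (sum_tmul_counit_eq (ℛ k h))
  simp only [map_sum, TensorProduct.rid_tmul, one_smul] at this
  conv_rhs => simp only [TensorProduct.AlgebraTensorModule.curry_apply, TensorProduct.curry_apply,
    coe_restrictScalars, LinearMap.id_apply, ← this]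
  simp [twistMap_tmul _ (ℛ k h), TensorProduct.sum_tmul, Algebra.algebraMap_eq_smul_one,
    TensorProduct.smul_tmul]

/-- The scalar-valued map `h ↦ σ(S(h⁽¹⁾), h⁽²⁾)`, with values in `End X`. -/
def antipodeScalar [IsCocomm k H] (X : Type) [AddCommGroup X] [Module k X]
    (sg : H →ₗ[k] H →ₗ[k] k) : WithConv (H →ₗ[k] Module.End k X) :=
  toConv ((Algebra.ofId k (Module.End k X)).toLinearMap ∘ₗ
    (TensorProduct.lift sg ∘ₗ (antipodeTmul k H).toLinearMap))

theorem antipodeScalar_convMul [IsCocomm k H] {sg sg' : H →ₗ[k] H →ₗ[k] k}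
    (hconv : IsConvInvPair k H sg sg') :
    antipodeScalar X sg * antipodeScalar X sg' = 1 := by
  have := algHom_comp_convMul_distrib (Algebra.ofId k (Module.End k X))
    (toConv (TensorProduct.lift sg ∘ₗ (antipodeTmul k H).toLinearMap))
    (toConv (TensorProduct.lift sg' ∘ₗ (antipodeTmul k H).toLinearMap))
  rw [convMul_antipodeTmul hconv] at this
  refine (congrArg toConv this).symm.trans ?_
  ext
  simp [Algebra.ofId_apply]

theorem convMul_comm_of_commute {C A : Type} [AddCommGroup C] [Module k C] [Coalgebra k C]
    [IsCocomm k C] [Ring A] [Algebra k A] {f g : C →ₗ[k] A} (h : ∀ x y, f x * g y = g y * f x) :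
    toConv f * toConv g = toConv g * toConv f := by
  ext x
  rw [(ℛ k x).convMul_apply, convMul_apply, ← comm_comul k x, ← (ℛ k x).eq]
  simp [h]

/-- `r` is a right module structure over the twisted algebra with multiplication `mu`. -/
structure IsRightAction (mu : H →ₗ[k] H →ₗ[k] H) (r : H →ₗ[k] Module.End k X) : Prop where
  map_one : r 1 = 1
  map_mul : ∀ h h', r h' * r h = r (mu h h')

variable [IsCocomm k H] {sg sg' : H →ₗ[k] H →ₗ[k] k} {mu : H →ₗ[k] H →ₗ[k] H}
  {r : H →ₗ[k] Module.End k X}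

theorem IsRightAction.convMul_antipode (hr : IsRightAction mu r) (hmu : IsTwistMul k H sg mu) :
    toConv r * toConv (r ∘ₗ antipode k) = antipodeScalar X sg := by
  ext x : 2
  have h1 := congrArg r (LinearMap.congr_fun (lift_comp_antipodeTmul hmu) x)
  rw [convMul_apply, ← comm_comul k x]
  simp only [antipodeTmul_toLinearMap, LinearMap.comp_apply, Algebra.linearMap_apply,
    antipodeScalar, Algebra.algebraMap_eq_smul_one, AlgHom.toLinearMap_apply, Algebra.ofId_apply,
    ← (ℛ k x).eq, map_sum, TensorProduct.map_tmul, TensorProduct.lift.tmul, TensorProduct.comm_tmul,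
    mul'_apply, ofConv_toConv, hr.map_mul, hr.map_one, map_smul, LinearMap.id_apply] at h1 ⊢
  exact h1

theorem IsRightAction.antipode_convMul (hr : IsRightAction mu r) (hmu : IsTwistMul k H sg mu)
    (hnorm : NormalK k H sg) (hcoc : CocycleK k H sg) :
    toConv (r ∘ₗ antipode k) * toConv r = antipodeScalar X sg := by
  ext x : 2
  have h1 := congrArg r (LinearMap.congr_fun (lift_comp_tmulAntipode hmu) x)
  rw [lift_comp_tmulAntipode_eq hnorm hcoc] at h1
  rw [convMul_apply, ← comm_comul k x]
  simp only [antipodeTmul_toLinearMap, tmulAntipode_toLinearMap, LinearMap.comp_apply,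
    Algebra.linearMap_apply,
    antipodeScalar, Algebra.algebraMap_eq_smul_one, AlgHom.toLinearMap_apply, Algebra.ofId_apply,
    ← (ℛ k x).eq, map_sum, TensorProduct.map_tmul, TensorProduct.lift.tmul, TensorProduct.comm_tmul,
    mul'_apply, ofConv_toConv, hr.map_mul, hr.map_one, map_smul, LinearMap.id_apply] at h1 ⊢
  exact h1

theorem IsRightAction.convMul_inv (hr : IsRightAction mu r) (hmu : IsTwistMul k H sg mu)
    (hconv : IsConvInvPair k H sg sg') :
    toConv r * (toConv (r ∘ₗ antipode k) * antipodeScalar X sg') = 1 := by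
  rw [← mul_assoc, hr.convMul_antipode hmu, antipodeScalar_convMul hconv]

theorem IsRightAction.inv_convMul (hr : IsRightAction mu r) (hmu : IsTwistMul k H sg mu)
    (hnorm : NormalK k H sg) (hcoc : CocycleK k H sg) (hconv : IsConvInvPair k H sg sg') :
    toConv (r ∘ₗ antipode k) * antipodeScalar X sg' * toConv r = 1 := by
  have hs : antipodeScalar X sg' * antipodeScalar X sg = 1 := by
    rw [← antipodeScalar_convMul (X := X) hconv]
    exact convMul_comm_of_commute fun x _ =>
      (Algebra.commute_algebraMap_left (A := Module.End k X)
        ((TensorProduct.lift sg' ∘ₗ (antipodeTmul k H).toLinearMap) x) _).eq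
  have hl : antipodeScalar X sg' * toConv (r ∘ₗ antipode k) * toConv r = 1 := by
    rw [mul_assoc, hr.antipode_convMul hmu hnorm hcoc, hs]
  rwa [← left_inv_eq_right_inv hl (hr.convMul_inv hmu hconv)]

theorem IsRightAction.bijective_twistMap (hr : IsRightAction mu r) (hmu : IsTwistMul k H sg mu)
    (hnorm : NormalK k H sg) (hcoc : CocycleK k H sg) (hconv : IsConvInvPair k H sg sg') :
    Function.Bijective (twistMap r) := by
  let q := toConv (r ∘ₗ antipode k) * antipodeScalar X sg'
  refine Function.bijective_iff_has_inverse.2 ⟨twistMap q.ofConv, fun x => ?_, fun x => ?_⟩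
  · have := twistMap_comp q.ofConv r
    rw [toConv_ofConv, hr.inv_convMul hmu hnorm hcoc hconv, twistMap_one] at this
    exact LinearMap.congr_fun this x
  · have := twistMap_comp r q.ofConv
    rw [toConv_ofConv, hr.convMul_inv hmu hconv, twistMap_one] at this
    exact LinearMap.congr_fun this x

/-- The triangle action is the convolution product of `r ∘ S`, the scalar `σ⁻¹(S(h⁽¹⁾), h⁽²⁾)`
and the left action. -/
theorem convMul_of_isTriangle {M : Type} [AddCommGroup M] [Module k M]
    {lact ract B : H →ₗ[k] M →ₗ[k] M} (hB : IsTriangle k H M sg' lact ract B)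
    (hcomm : ∀ h h' m, lact h (ract h' m) = ract h' (lact h m)) :
    (toConv B : WithConv (H →ₗ[k] Module.End k M)) =
      toConv ((ract : H →ₗ[k] Module.End k M) ∘ₗ antipode k) *
        (antipodeScalar M sg' * toConv (lact : H →ₗ[k] Module.End k M)) := by
  ext h m
  have hB' := hB h m (iterReprSucc (ℛ k h) fun i => iterReprSucc (ℛ k _) fun j =>
    iterReprOfRepr (ℛ k _))
  refine hB'.trans ?_
  simp only [iterReprSucc, iterReprOfRepr, Finset.sum_sigma, Fin.cons_zero]
  rw [(ℛ k h).convMul_apply]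
  simp only [LinearMap.sum_apply]
  refine Finset.sum_congr rfl fun i _ => ?_
  generalize (ℛ k h).left i = a
  generalize (ℛ k h).right i = b
  have key := congrArg (TensorProduct.lift ((lsmul k M).compl₁₂
    (TensorProduct.lift (sg' ∘ₗ antipode k)) (lact.flip m)) ∘ₗ
      (TensorProduct.assoc k H H H).symm.toLinearMap)
    (sum_tmul_tmul_eq (ℛ k b) (fun i => ℛ k ((ℛ k b).left i)) (fun i => ℛ k ((ℛ k b).right i)))
  simp only [map_sum, LinearMap.comp_apply, LinearEquiv.coe_coe, TensorProduct.assoc_symm_tmul,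
    TensorProduct.lift.tmul, compl₁₂_apply, flip_apply, lsmul_apply] at key
  rw [(ℛ k b).convMul_apply]
  simp only [antipodeScalar, antipodeTmul_toLinearMap, LinearMap.comp_apply,
    AlgHom.toLinearMap_apply, Algebra.ofId_apply, Algebra.algebraMap_eq_smul_one,
    ← (ℛ k ((ℛ k b).left _)).eq, map_sum, TensorProduct.map_tmul, TensorProduct.lift.tmul,
    LinearMap.id_apply, Finset.sum_mul, LinearMap.sum_apply, Module.End.mul_apply,
    LinearMap.smul_apply, Module.End.one_apply, map_smul, hcomm, ofConv_toConv]
  have key' := congrArg (ract (antipode k a)) key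
  simp only [map_sum, map_smul] at key'
  exact key'.symm

/-- Convolving the triangle action with the right action gives the left action. -/
theorem convMul_eq_of_isTriangle {M : Type} [AddCommGroup M] [Module k M]
    {lact ract B : H →ₗ[k] M →ₗ[k] M} (hB : IsTriangle k H M sg' lact ract B)
    (hcomm : ∀ h h' m, lact h (ract h' m) = ract h' (lact h m))
    (hr : IsRightAction mu (X := M) ract) (hmu : IsTwistMul k H sg mu)
    (hnorm : NormalK k H sg) (hcoc : CocycleK k H sg) (hconv : IsConvInvPair k H sg sg') :
    (toConv B * toConv ract : WithConv (H →ₗ[k] Module.End k M)) = toConv lact := by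
  have hlr : (toConv lact * toConv ract : WithConv (H →ₗ[k] Module.End k M)) =
      toConv ract * toConv lact :=
    convMul_comm_of_commute (f := (lact : H →ₗ[k] Module.End k M)) (g := ract)
      fun x y => LinearMap.ext fun m => hcomm x y m
  rw [convMul_of_isTriangle hB hcomm, mul_assoc, mul_assoc, hlr, ← mul_assoc, ← mul_assoc,
    hr.inv_convMul hmu hnorm hcoc hconv, one_mul]

end Action

section TensorPower

variable {k H M}

/-- Prepending a factor: `H ⊗ (H^{⊗n} ⊗ M) ≃ H^{⊗(n+1)} ⊗ M`. -/
def tcons (n : ℕ) : H ⊗[k] TpowM k H M n ≃ₗ[k] TpowM k H M (n + 1) :=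
  LinearEquiv.refl k (H ⊗[k] TpowM k H M n)

theorem tpowM_succ (n : ℕ) (f : Fin (n + 1) → H) (m : M) :
    tpowM k H M (n + 1) f m = tcons n (f 0 ⊗ₜ tpowM k H M n (fun i => f i.succ) m) := rfl

theorem tcons_ext {n : ℕ} {Y : Type} [AddCommGroup Y] [Module k Y]
    {d d' : TpowM k H M (n + 1) →ₗ[k] Y}
    (h : ∀ a x, d (tcons n (a ⊗ₜ x)) = d' (tcons n (a ⊗ₜ x))) : d = d' := by
  have : d ∘ₗ (tcons n).toLinearMap = d' ∘ₗ (tcons n).toLinearMap := TensorProduct.ext' h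
  exact (LinearEquiv.eq_comp_toLinearMap_iff _ _).1 this

theorem tpowM_ext : ∀ {n : ℕ} {Y : Type} [AddCommGroup Y] [Module k Y]
    {d d' : TpowM k H M n →ₗ[k] Y}, (∀ f m, d (tpowM k H M n f m) = d' (tpowM k H M n f m)) → d = d'
  | 0, _, _, _, _, _, h => LinearMap.ext fun m => h Fin.elim0 m
  | n + 1, _, _, _, d, d', h => tcons_ext fun a => LinearMap.congr_fun <|
      tpowM_ext (d := d ∘ₗ (tcons n).toLinearMap ∘ₗ TensorProduct.mk k H _ a)
        (d' := d' ∘ₗ (tcons n).toLinearMap ∘ₗ TensorProduct.mk k H _ a)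
        fun f m => h (Fin.cons a f) m

/-- The map `id_H ⊗ d`. -/
def consMap {n n' : ℕ} : (TpowM k H M n →ₗ[k] TpowM k H M n') →ₗ[k]
    TpowM k H M (n + 1) →ₗ[k] TpowM k H M (n' + 1) :=
  ((tcons n).arrowCongr (tcons n')).toLinearMap ∘ₗ lTensorHom H

@[simp]
theorem consMap_tcons {n n' : ℕ} (d : TpowM k H M n →ₗ[k] TpowM k H M n') (h : H)
    (x : TpowM k H M n) : consMap d (tcons n (h ⊗ₜ x)) = tcons n' (h ⊗ₜ d x) := by
  simp [consMap]

/-- The right action of `H_σ` on `H^{⊗n} ⊗ M` through `M`. -/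
def rAct (r : H →ₗ[k] M →ₗ[k] M) : (n : ℕ) → H →ₗ[k] Module.End k (TpowM k H M n)
  | 0 => r
  | n + 1 => consMap ∘ₗ rAct r n

@[simp]
theorem rAct_tcons (r : H →ₗ[k] M →ₗ[k] M) (n : ℕ) (h a : H) (x : TpowM k H M n) :
    rAct r (n + 1) h (tcons n (a ⊗ₜ x)) = tcons n (a ⊗ₜ rAct r n h x) :=
  consMap_tcons _ a x

theorem rAct_tpowM (r : H →ₗ[k] M →ₗ[k] M) (h : H) (m : M) : ∀ (n : ℕ) (f : Fin n → H),
    rAct r n h (tpowM k H M n f m) = tpowM k H M n f (r h m)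
  | 0, _ => rfl
  | n + 1, f => by rw [tpowM_succ, rAct_tcons, rAct_tpowM, tpowM_succ]

theorem isRightAction_rAct {mu : H →ₗ[k] H →ₗ[k] H} {r : H →ₗ[k] M →ₗ[k] M}
    (hr : IsRightAction mu (X := M) r) :
    ∀ n, IsRightAction mu (rAct r n)
  | 0 => hr
  | n + 1 => by
    have := isRightAction_rAct hr n
    refine ⟨tcons_ext fun a x => ?_, fun h h' => tcons_ext fun a x => ?_⟩
    · simp [this.map_one]
    · simp [← this.map_mul]

/-- The map `Θ`, defined by the recursion `Θ(h ⊗ x) = h⁽¹⁾ ⊗ Θ(x · h⁽²⁾)`. -/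
def theta (r : H →ₗ[k] M →ₗ[k] M) : (n : ℕ) → TpowM k H M n →ₗ[k] TpowM k H M n
  | 0 => LinearMap.id
  | n + 1 => consMap (theta r n) ∘ₗ (tcons n).conj (twistMap (rAct r n))

theorem theta_tcons (r : H →ₗ[k] M →ₗ[k] M) (n : ℕ) {h : H} {ι : Type} (R : Coalgebra.Repr k h ι)
    (x : TpowM k H M n) : theta r (n + 1) (tcons n (h ⊗ₜ x)) =
      ∑ i ∈ R.index, tcons n (R.left i ⊗ₜ theta r n (rAct r n (R.right i) x)) := by
  simp [theta, LinearEquiv.conj_apply, twistMap_tmul _ R]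

theorem theta_tpowM (r : H →ₗ[k] M →ₗ[k] M) : ∀ (n : ℕ) (f : Fin n → H) (m : M),
    theta r n (tpowM k H M n f m) =
      ∑ e ∈ Fintype.piFinset (fun i => (ℛ k (f i)).index),
        tpowM k H M n (fun i => (ℛ k (f i)).left (e i))
          ((List.ofFn (fun i : Fin n => (ℛ k (f i)).right (e i))).foldl (fun m' h => r h m') m)
  | 0, f, m => by
    simp only [theta, tpowM, List.ofFn_zero, List.foldl_nil, Fintype.piFinset_of_isEmpty]
    exact (Finset.sum_singleton _ _).symm
  | n + 1, f, m => by
    rw [tpowM_succ, theta_tcons r n (ℛ k (f 0))]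
    simp only [rAct_tpowM, theta_tpowM r n, TensorProduct.tmul_sum, map_sum]
    rw [← Finset.sum_product']
    refine Finset.sum_bij' (fun p _ => Fin.cons p.1 p.2) (fun e _ => (e 0, fun i => e i.succ))
      ?_ ?_ ?_ ?_ ?_
    · intro p hp
      simpa [Fin.forall_fin_succ] using hp
    · intro e he
      simpa [Fin.forall_fin_succ] using he
    · intro p hp
      simp
    · intro e he
      exact Fin.cons_self_tail e
    · intro p hp
      simp [tpowM_succ, List.ofFn_succ]

theorem eq_theta_of_isTheta [IsCocomm k H] {r : H →ₗ[k] M →ₗ[k] M} {n : ℕ}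
    {Th : TpowM k H M n →ₗ[k] TpowM k H M n} (hTh : IsTheta k H M r n Th) : Th = theta r n :=
  tpowM_ext fun f m => by
    rw [theta_tpowM]
    exact hTh f m fun i => iterReprOfRepr
      { index := (ℛ k (f i)).index
        left := (ℛ k (f i)).right
        right := (ℛ k (f i)).left
        eq := by
          rw [← comm_comul k (f i), ← (ℛ k (f i)).eq]
          simp }

theorem bijective_theta [IsCocomm k H] {sg sg' : H →ₗ[k] H →ₗ[k] k} {mu : H →ₗ[k] H →ₗ[k] H}
    {r : H →ₗ[k] M →ₗ[k] M} (hr : IsRightAction mu (X := M) r) (hmu : IsTwistMul k H sg mu)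
    (hnorm : NormalK k H sg) (hcoc : CocycleK k H sg) (hconv : IsConvInvPair k H sg sg') :
    ∀ n, Function.Bijective (theta r n : TpowM k H M n →ₗ[k] TpowM k H M n)
  | 0 => Function.bijective_id
  | n + 1 => by
    let e := LinearEquiv.ofBijective _ (bijective_theta hr hmu hnorm hcoc hconv n)
    have he : (consMap (theta r n) : TpowM k H M (n + 1) →ₗ[k] _) =
        ((tcons n).symm ≪≫ₗ e.lTensor H ≪≫ₗ tcons n).toLinearMap :=
      tcons_ext fun a x => by simp [e]
    rw [theta, he]
    have ht := (((isRightAction_rAct hr n).bijective_twistMap hmu hnorm hcoc hconv).comp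
      (tcons n).symm.bijective)
    exact ((tcons n).symm ≪≫ₗ e.lTensor H ≪≫ₗ tcons n).bijective.comp ((tcons n).bijective.comp ht)

end TensorPower

section Faces

variable {k H M}

/-- The zeroth face `h ⊗ x ↦ l(h) x` defined by an operation `l` of `H` on `H^{⊗n} ⊗ M`. -/
def face0 {n : ℕ} (l : H →ₗ[k] Module.End k (TpowM k H M n)) :
    TpowM k H M (n + 1) →ₗ[k] TpowM k H M n :=
  TensorProduct.lift l ∘ₗ (tcons n).symm.toLinearMap

@[simp]
theorem face0_tcons {n : ℕ} (l : H →ₗ[k] Module.End k (TpowM k H M n)) (h : H)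
    (x : TpowM k H M n) : face0 l (tcons n (h ⊗ₜ x)) = l h x := by
  simp [face0]

/-- The map multiplying the first two factors of `H^{⊗(n+2)} ⊗ M` by means of `mu`. -/
def mulHead (mu : H →ₗ[k] H →ₗ[k] H) (n : ℕ) :
    TpowM k H M (n + 2) →ₗ[k] TpowM k H M (n + 1) :=
  (tcons n).toLinearMap ∘ₗ rTensor _ (TensorProduct.lift mu) ∘ₗ
    (TensorProduct.assoc k H H _).symm.toLinearMap ∘ₗ lTensor H (tcons n).symm.toLinearMap ∘ₗ
      (tcons (n + 1)).symm.toLinearMap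

@[simp]
theorem mulHead_tcons (mu : H →ₗ[k] H →ₗ[k] H) (n : ℕ) (h g : H) (x : TpowM k H M n) :
    mulHead mu n (tcons (n + 1) (h ⊗ₜ tcons n (g ⊗ₜ x))) = tcons n (mu h g ⊗ₜ x) := by
  simp [mulHead]

/-- The middle faces defined by a multiplication `mu` on `H`. -/
def faceMid (mu : H →ₗ[k] H →ₗ[k] H) :
    (n : ℕ) → Fin n → TpowM k H M (n + 1) →ₗ[k] TpowM k H M n
  | 0 => fun i => i.elim0
  | n + 1 => Fin.cases (mulHead mu n) fun i => consMap (faceMid mu n i)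

/-- The last face defined by an operation of `H` on `M`. -/
def faceLast (l : H →ₗ[k] M →ₗ[k] M) : (n : ℕ) → TpowM k H M (n + 1) →ₗ[k] TpowM k H M n
  | 0 => face0 (n := 0) l
  | n + 1 => consMap (faceLast l n)

/-- The degeneracies. -/
def degen : (n : ℕ) → Fin (n + 1) → TpowM k H M n →ₗ[k] TpowM k H M (n + 1)
  | 0 => fun _ => (tcons 0).toLinearMap ∘ₗ TensorProduct.mk k H _ 1
  | n + 1 => Fin.cases ((tcons (n + 1)).toLinearMap ∘ₗ TensorProduct.mk k H _ 1) fun i =>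
      consMap (degen n i)

theorem mergeAt_zero {V : Type} {n : ℕ} (f : Fin (n + 2) → V) (v : V) :
    mergeAt 0 f v = Fin.cons v fun i => f i.succ.succ := by
  funext j
  refine Fin.cases ?_ (fun j => ?_) j <;> simp [mergeAt]

theorem mergeAt_succ {V : Type} {n : ℕ} (i : Fin n) (f : Fin (n + 2) → V) (v : V) :
    mergeAt i.succ f v = Fin.cons (f 0) (mergeAt i (fun i => f i.succ) v) := by
  funext j
  refine Fin.cases ?_ (fun j => ?_) j <;> simp [mergeAt]

theorem faceMid_tpowM (mu : H →ₗ[k] H →ₗ[k] H) (m : M) : ∀ (n : ℕ) (i : Fin n)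
    (f : Fin (n + 1) → H), faceMid mu n i (tpowM k H M (n + 1) f m) =
      tpowM k H M n (mergeAt i f (mu (f i.castSucc) (f i.succ))) m
  | n + 1, i, f => by
    refine Fin.cases ?_ (fun i => ?_) i
    · rw [mergeAt_zero]
      exact mulHead_tcons mu n (f 0) (f 1) _
    · rw [mergeAt_succ]
      refine (consMap_tcons (faceMid mu n i) (f 0) _).trans ?_
      rw [faceMid_tpowM]
      rfl

theorem faceLast_tpowM (l : H →ₗ[k] M →ₗ[k] M) (m : M) : ∀ (n : ℕ) (f : Fin (n + 1) → H),
    faceLast l n (tpowM k H M (n + 1) f m) =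
      tpowM k H M n (fun i => f i.castSucc) (l (f (Fin.last n)) m)
  | 0, f => face0_tcons (n := 0) l (f 0) m
  | n + 1, f => by
    refine (consMap_tcons (faceLast l n) (f 0) _).trans ?_
    rw [faceLast_tpowM]
    rfl

theorem degen_tpowM (m : M) : ∀ (n : ℕ) (i : Fin (n + 1)) (f : Fin n → H),
    degen n i (tpowM k H M n f m) = tpowM k H M (n + 1) (i.insertNth 1 f) m
  | 0, i, f => by
    obtain rfl : i = 0 := Subsingleton.elim (α := Fin 1) i 0
    rw [Fin.insertNth_zero']
    rfl
  | n + 1, i, f => by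
    refine Fin.cases ?_ (fun i => ?_) i
    · rw [Fin.insertNth_zero']
      rfl
    · refine (consMap_tcons (degen n i) (f 0) _).trans ?_
      have hi : i.succ.insertNth 1 f =
          (Fin.cons (f 0) (i.insertNth 1 fun j => f j.succ : Fin (n + 1) → H) : Fin (n + 2) → H) := by
        rw [← Fin.insertNth_succ_cons]
        exact congrArg _ (Fin.cons_self_tail f).symm
      rw [degen_tpowM, hi]
      rfl

/-- `d` commutes with the right actions, and the maps `theta` intertwine `d` with `d'`. -/
structure Intertwines (r : H →ₗ[k] M →ₗ[k] M) {n n' : ℕ}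
    (d d' : TpowM k H M n →ₗ[k] TpowM k H M n') : Prop where
  rAct_comm : ∀ h x, d (rAct r n h x) = rAct r n' h (d x)
  theta_comm : d' ∘ₗ theta r n = theta r n' ∘ₗ d

theorem Intertwines.cons {r : H →ₗ[k] M →ₗ[k] M} {n n' : ℕ}
    {d d' : TpowM k H M n →ₗ[k] TpowM k H M n'} (h : Intertwines r d d') :
    Intertwines r (consMap d) (consMap d') where
  rAct_comm a := LinearMap.congr_fun (f := consMap d ∘ₗ rAct r (n + 1) a)
    (g := rAct r (n' + 1) a ∘ₗ consMap d) <| tcons_ext fun b x => by simp [h.rAct_comm]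
  theta_comm := tcons_ext fun a x => by
    have := LinearMap.congr_fun h.theta_comm
    simp only [LinearMap.comp_apply] at this
    simp [theta_tcons _ _ (ℛ k a), this, h.rAct_comm]

/-- The multiplication of the twisted algebra satisfies
`Δ(h̄ · ḡ) = h⁽¹⁾g⁽¹⁾ ⊗ h̄⁽²⁾ · ḡ⁽²⁾`. -/
theorem comul_twistMul [IsCocomm k H] {sg : H →ₗ[k] H →ₗ[k] k} {mu : H →ₗ[k] H →ₗ[k] H}
    (hmu : IsTwistMul k H sg mu) :
    comul ∘ₗ TensorProduct.lift mu =
      TensorProduct.map (mul' k H) (TensorProduct.lift mu) ∘ₗ comul := by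
  let iL : H →ₐ[k] H ⊗[k] H := Algebra.TensorProduct.includeLeft
  let iR : H →ₐ[k] H ⊗[k] H := Algebra.TensorProduct.includeRight
  let s : WithConv (H ⊗[k] H →ₗ[k] H ⊗[k] H) :=
    toConv (Algebra.linearMap k (H ⊗[k] H) ∘ₗ TensorProduct.lift sg)
  have hs (F : H →ₐ[k] H ⊗[k] H) : toConv (F.toLinearMap ∘ₗ TensorProduct.lift mu) =
      s * toConv (F.toLinearMap ∘ₗ mul' k H) := by
    have := algHom_comp_convMul_distrib F
      (toConv (Algebra.linearMap k H ∘ₗ TensorProduct.lift sg)) (toConv (mul' k H))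
    rw [← convMul_of_isTwistMul hmu] at this
    have e : F.toLinearMap ∘ₗ (Algebra.linearMap k H ∘ₗ TensorProduct.lift sg) =
        Algebra.linearMap k (H ⊗[k] H) ∘ₗ TensorProduct.lift sg := by
      ext
      simp
    refine (congrArg toConv this).trans ?_
    simp only [toConv_ofConv, e, s]
  have hmap (f : H ⊗[k] H →ₗ[k] H) : toConv (TensorProduct.map (mul' k H) f ∘ₗ comul) =
      toConv (iL.toLinearMap ∘ₗ mul' k H) * toConv (iR.toLinearMap ∘ₗ f) := by
    refine congrArg toConv (LinearMap.ext fun x => ?_)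
    refine Eq.trans ?_ ((ℛ k x).convMul_apply (toConv (iL.toLinearMap ∘ₗ mul' k H))
      (toConv (iR.toLinearMap ∘ₗ f))).symm
    simp [← (ℛ k x).eq, iL, iR]
  have hcomul : (Bialgebra.comulAlgHom k H).toLinearMap ∘ₗ mul' k H =
      TensorProduct.map (mul' k H) (mul' k H) ∘ₗ comul :=
    ((Bialgebra.mulCoalgHom k H).map_comp_comul).symm
  have hcomm : s * toConv (iL.toLinearMap ∘ₗ mul' k H) =
      toConv (iL.toLinearMap ∘ₗ mul' k H) * s :=
    convMul_comm_of_commute fun x y =>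
      (Algebra.commute_algebraMap_left (A := H ⊗[k] H) (TensorProduct.lift sg x) _).eq
  apply toConv_injective
  rw [hmap, hs iR, ← mul_assoc, ← hcomm, mul_assoc, ← hmap, ← hcomul]
  exact hs (Bialgebra.comulAlgHom k H)

theorem intertwines_mulHead [IsCocomm k H] {sg : H →ₗ[k] H →ₗ[k] k} {mu : H →ₗ[k] H →ₗ[k] H}
    (hmu : IsTwistMul k H sg mu) {r : H →ₗ[k] M →ₗ[k] M} (hr : IsRightAction mu (X := M) r)
    (n : ℕ) : Intertwines r (mulHead mu n) (mulHead (LinearMap.mul k H) n) where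
  rAct_comm a := LinearMap.congr_fun (f := mulHead mu n ∘ₗ rAct r (n + 2) a)
    (g := rAct r (n + 1) a ∘ₗ mulHead mu n) <| tcons_ext fun b => LinearMap.congr_fun
      (f := (mulHead mu n ∘ₗ rAct r (n + 2) a) ∘ₗ (tcons (n + 1)).toLinearMap ∘ₗ
        TensorProduct.mk k H _ b)
      (g := (rAct r (n + 1) a ∘ₗ mulHead mu n) ∘ₗ (tcons (n + 1)).toLinearMap ∘ₗ
        TensorProduct.mk k H _ b) <| tcons_ext fun c x => by simp
  theta_comm := by
    have hr' := isRightAction_rAct hr n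
    refine tcons_ext fun h => LinearMap.congr_fun
      (f := (mulHead (LinearMap.mul k H) n ∘ₗ theta r (n + 2)) ∘ₗ (tcons (n + 1)).toLinearMap ∘ₗ
        TensorProduct.mk k H _ h)
      (g := (theta r (n + 1) ∘ₗ mulHead mu n) ∘ₗ (tcons (n + 1)).toLinearMap ∘ₗ
        TensorProduct.mk k H _ h) <| tcons_ext fun g x => ?_
    have hΔ := congrArg (tcons n ∘ lTensor H (theta r n ∘ₗ (rAct r n).flip x))
      (LinearMap.congr_fun (comul_twistMul hmu) (h ⊗ₜ g))
    simp only [Function.comp_apply, LinearMap.comp_apply, TensorProduct.lift.tmul,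
      ← (ℛ k (mu h g)).eq, ← ((ℛ k h).tmul (ℛ k g)).eq, Coalgebra.Repr.tmul, Finset.sum_product,
      map_sum, lTensor_tmul, TensorProduct.map_tmul, mul'_apply, flip_apply, ← hr'.map_mul,
      Module.End.mul_apply] at hΔ
    simp [theta_tcons _ _ (ℛ k h), theta_tcons _ _ (ℛ k g), theta_tcons _ _ (ℛ k (mu h g)),
      TensorProduct.tmul_sum, hΔ]

theorem intertwines_faceMid [IsCocomm k H] {sg : H →ₗ[k] H →ₗ[k] k} {mu : H →ₗ[k] H →ₗ[k] H}
    (hmu : IsTwistMul k H sg mu) {r : H →ₗ[k] M →ₗ[k] M} (hr : IsRightAction mu (X := M) r) :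
    ∀ (n : ℕ) (i : Fin n), Intertwines r (faceMid mu n i) (faceMid (LinearMap.mul k H) n i)
  | n + 1, i => by
    refine Fin.cases ?_ (fun i => ?_) i
    · exact intertwines_mulHead hmu hr n
    · exact (intertwines_faceMid hmu hr n i).cons

theorem intertwines_faceLast {r l B : H →ₗ[k] M →ₗ[k] M}
    (hB : (toConv B * toConv r : WithConv (H →ₗ[k] Module.End k M)) = toConv l)
    (hcomm : ∀ h h' m, l h (r h' m) = r h' (l h m)) :
    ∀ n : ℕ, Intertwines r (faceLast l n) (faceLast B n)
  | 0 => by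
    refine ⟨fun h => LinearMap.congr_fun (f := faceLast l 0 ∘ₗ rAct r 1 h)
      (g := rAct r 0 h ∘ₗ faceLast l 0) <| tcons_ext fun a x => ?_, tcons_ext fun a x => ?_⟩
    · have h1 := face0_tcons (M := M) (n := 0) l
      simp only [faceLast, LinearMap.comp_apply, rAct_tcons]
      rw [h1, h1]
      exact hcomm a h x
    · have h1 := face0_tcons (k := k) (H := H) (M := M) (n := 0)
      have h2 (y : M) :
          ∑ i ∈ (ℛ k a).index, B ((ℛ k a).left i) (r ((ℛ k a).right i) y) = l a y := by
        have := LinearMap.congr_fun (congrArg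
          (fun f : WithConv (H →ₗ[k] Module.End k M) => f.ofConv a) hB) y
        rw [(ℛ k a).convMul_apply] at this
        exact (LinearMap.sum_apply _ _ _).symm.trans this
      simp only [faceLast, LinearMap.comp_apply, theta_tcons _ _ (ℛ k a), map_sum]
      rw [h1 l]
      exact (Finset.sum_congr rfl fun i _ => h1 B _ _).trans (h2 x)
  | n + 1 => (intertwines_faceLast hB hcomm n).cons

theorem intertwines_mk_one {r : H →ₗ[k] M →ₗ[k] M} {n : ℕ} (hr : rAct r n 1 = 1) :
    Intertwines r ((tcons n).toLinearMap ∘ₗ TensorProduct.mk k H (TpowM k H M n) 1)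
      ((tcons n).toLinearMap ∘ₗ TensorProduct.mk k H (TpowM k H M n) 1) where
  rAct_comm h x := by simp
  theta_comm := by
    let R : Coalgebra.Repr k (1 : H) Unit :=
      { index := {()}
        left := 1
        right := 1
        eq := by simp [Algebra.TensorProduct.one_def] }
    ext x
    simp [theta_tcons r n R, R, hr]

theorem intertwines_degen {mu : H →ₗ[k] H →ₗ[k] H} {r : H →ₗ[k] M →ₗ[k] M}
    (hr : IsRightAction mu (X := M) r) :
    ∀ (n : ℕ) (i : Fin (n + 1)), Intertwines r (degen n i) (degen n i)
  | 0, i => intertwines_mk_one (isRightAction_rAct hr 0).map_one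
  | n + 1, i => by
    refine Fin.cases ?_ (fun i => ?_) i
    · exact intertwines_mk_one (isRightAction_rAct hr (n + 1)).map_one
    · exact (intertwines_degen hr n i).cons

theorem face0_comp_theta (r : H →ₗ[k] M →ₗ[k] M) (n : ℕ) :
    face0 ((Algebra.ofId k (Module.End k (TpowM k H M n))).toLinearMap ∘ₗ counit) ∘ₗ
      theta r (n + 1) = theta r n ∘ₗ face0 (rAct r n) := by
  refine tcons_ext fun h x => ?_
  have := congrArg (theta r n ∘ₗ (rAct r n).flip x) (sum_counit_smul (ℛ k h))
  simp only [map_sum, map_smul, LinearMap.comp_apply, flip_apply] at this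
  simp [theta_tcons _ _ (ℛ k h), Algebra.ofId_apply, Algebra.algebraMap_eq_smul_one, this]

end Faces

end MacLane

open MacLane

/-- **Mac Lane isomorphism for Hopf crossed products.** Let `H` be
cocommutative, `σ : H ⊗ H → k` a convolution invertible normal 2-cocycle, `H_σ = k #_σ H`,
`M` an `H_σ`-bimodule, and `M̃` the left `H`-module `h ▶ m = σ⁻¹(S(h⁽²⁾),h⁽³⁾)·h̄⁽⁴⁾ m S(h⁽¹⁾)‾`.
Then for every `n` the map `Θ(h̄₁ ⊗ ⋯ ⊗ h̄ₙ ⊗ m) = h₁⁽²⁾ ⊗ ⋯ ⊗ hₙ⁽²⁾ ⊗ m·h̄₁⁽¹⁾⋯h̄ₙ⁽¹⁾` is an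
isomorphism of simplicial `k`-modules from the Hochschild complex `C_•(H_σ,M)` to the Hopf
homology complex `C_•(H;M̃)`: it is bijective and commutes with all faces and degeneracies. -/
theorem macLane_iso_hopf_crossed_product
    (k : Type) [Field k] (H : Type) [Ring H] [HopfAlgebra k H]
    (hco : Cocomm k H)
    (sg sg' : H →ₗ[k] H →ₗ[k] k)
    (hnorm : NormalK k H sg) (hcoc : CocycleK k H sg)
    (hconv : IsConvInvPair k H sg sg')
    (M : Type) [AddCommGroup M] [Module k M]
    (mu : H →ₗ[k] H →ₗ[k] H) (hmu : IsTwistMul k H sg mu)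
    (lact ract : H →ₗ[k] M →ₗ[k] M)
    (hbim : IsSigmaBimodule k H M mu lact ract)
    (B : H →ₗ[k] M →ₗ[k] M) (hB : IsTriangle k H M sg' lact ract B)
    (n : ℕ)
    (Th : (TpowM k H M n : Type) →ₗ[k] (TpowM k H M n : Type))
    (Th1 : (TpowM k H M (n + 1) : Type) →ₗ[k] (TpowM k H M (n + 1) : Type))
    (hTh : IsTheta k H M ract n Th) (hTh1 : IsTheta k H M ract (n + 1) Th1)
    (hoch0 hochLast hopf0 hopfLast :
      (TpowM k H M (n + 1) : Type) →ₗ[k] (TpowM k H M n : Type))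
    (hochMid hopfMid :
      Fin n → ((TpowM k H M (n + 1) : Type) →ₗ[k] (TpowM k H M n : Type)))
    (hochDeg hopfDeg :
      Fin (n + 1) → ((TpowM k H M n : Type) →ₗ[k] (TpowM k H M (n + 1) : Type)))
    (hhoch0 : IsHochFace0 k H M ract n hoch0)
    (hhochMid : ∀ i : Fin n, IsHochFaceMid k H M mu n i (hochMid i))
    (hhochLast : IsHochFaceLast k H M lact n hochLast)
    (hhochDeg : ∀ i : Fin (n + 1), IsDegen k H M n i (hochDeg i))
    (hhopf0 : IsHopfFace0 k H M n hopf0)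
    (hhopfMid : ∀ i : Fin n, IsHopfFaceMid k H M n i (hopfMid i))
    (hhopfLast : IsHopfFaceLast k H M B n hopfLast)
    (hhopfDeg : ∀ i : Fin (n + 1), IsDegen k H M n i (hopfDeg i)) :
    Function.Bijective Th ∧
    hopf0 ∘ₗ Th1 = Th ∘ₗ hoch0 ∧
    (∀ i : Fin n, hopfMid i ∘ₗ Th1 = Th ∘ₗ hochMid i) ∧
    hopfLast ∘ₗ Th1 = Th ∘ₗ hochLast ∧
    (∀ i : Fin (n + 1), hopfDeg i ∘ₗ Th = Th1 ∘ₗ hochDeg i) := by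
  obtain ⟨hll, hl1, hrr, hr1, hcomm⟩ := hbim
  have : Coalgebra.IsCocomm k H := ⟨LinearMap.ext hco⟩
  have hr : IsRightAction mu (X := M) ract :=
    ⟨LinearMap.ext hr1, fun h h' => LinearMap.ext (hrr h h')⟩
  have hBr := convMul_eq_of_isTriangle hB hcomm hr hmu hnorm hcoc hconv
  obtain rfl := eq_theta_of_isTheta hTh
  obtain rfl := eq_theta_of_isTheta hTh1
  have e1 : hoch0 = face0 (rAct ract n) := tpowM_ext fun f m => by
    rw [hhoch0, tpowM_succ, face0_tcons, rAct_tpowM]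
  have e2 : hopf0 = face0 ((Algebra.ofId k (Module.End k (TpowM k H M n))).toLinearMap ∘ₗ
      Coalgebra.counit) := tpowM_ext fun f m => by
    rw [hhopf0, tpowM_succ, face0_tcons]
    simp [Algebra.ofId_apply, Algebra.algebraMap_eq_smul_one]
  have e3 (i : Fin n) : hochMid i = faceMid mu n i := tpowM_ext fun f m => by
    rw [hhochMid, faceMid_tpowM]
  have e4 (i : Fin n) : hopfMid i = faceMid (LinearMap.mul k H) n i := tpowM_ext fun f m => by
    rw [hhopfMid, faceMid_tpowM, LinearMap.mul_apply']
  have e5 : hochLast = faceLast lact n := tpowM_ext fun f m => by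
    rw [hhochLast, faceLast_tpowM]
  have e6 : hopfLast = faceLast B n := tpowM_ext fun f m => by
    rw [hhopfLast, faceLast_tpowM]
  have e7 (i : Fin (n + 1)) : hochDeg i = degen n i := tpowM_ext fun f m => by
    rw [hhochDeg, degen_tpowM]
  have e8 (i : Fin (n + 1)) : hopfDeg i = degen n i := tpowM_ext fun f m => by
    rw [hhopfDeg, degen_tpowM]
  refine ⟨bijective_theta hr hmu hnorm hcoc hconv n, ?_, fun i => ?_, ?_, fun i => ?_⟩
  · rw [e1, e2]
    exact face0_comp_theta ract n
  · rw [e3, e4]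
    exact (intertwines_faceMid hmu hr n i).theta_comm
  · rw [e5, e6]
    exact (intertwines_faceLast hBr hcomm n).theta_comm
  · rw [e7, e8]
    exact (intertwines_degen hr n i).theta_comm
end
end

section
/- Let H be a cocommutative Hopf algebra over a field k, σ : H⊗H → k a convolution invertible, normal 2-cocycle, H_σ = k#_σH, and M an H_σ-bimodule. Then for every n ≥ 0 the maps Θ(overline{h_1}⊗⋯⊗overline{h_n}⊗m) = h_1⁽²⁾⊗⋯⊗h_n⁽²⁾⊗ m·overline{h_1⁽¹⁾}⋯overline{h_n⁽¹⁾} and 𝔗(h_1⊗⋯⊗h_n⊗m) = σ⁻¹(S(h_1⁽²⁾),h_1⁽³⁾)⋯σ⁻¹(S(h_n⁽²⁾),h_n⁽³⁾) · overline{h_1⁽⁴⁾}⊗⋯⊗overline{h_n⁽⁴⁾}⊗ m·overline{S(h_n⁽¹⁾)}⋯overline{S(h_1⁽¹⁾)} are mutually inverse k-linear maps between H_σ^{⊗n}⊗M and H^{⊗n}⊗M: 𝔗∘Θ = id and Θ∘𝔗 = id. -/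
open TensorProduct

noncomputable section

variable (k : Type) [Field k] (H : Type) [Ring H] [HopfAlgebra k H]

variable (A : Type) [Ring A] [Algebra k A]
variable (rho : H →ₗ[k] A →ₗ[k] A)

variable (sg : H →ₗ[k] H →ₗ[k] k)

/-! ## The twisted algebra `H_σ = k #_σ H` and `H_σ`-bimodules -/

variable (M : Type) [AddCommGroup M] [Module k M]
variable (mu : H →ₗ[k] H →ₗ[k] H) (sg' : H →ₗ[k] H →ₗ[k] k)
variable (lact ract : H →ₗ[k] M →ₗ[k] M)

open Coalgebra HopfAlgebra WithConv

section Convolution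

variable {R C A : Type*} [CommRing R] [Ring C] [HopfAlgebra R C] [Ring A] [Algebra R A]

lemma convOne_comp_coalgHom {D E : Type*} [AddCommGroup D] [Module R D] [Coalgebra R D]
    [AddCommGroup E] [Module R E] [Coalgebra R E] (h : D →ₗc[R] E) :
    (1 : WithConv (E →ₗ[R] A)).ofConv ∘ₗ h.toLinearMap = (1 : WithConv (D →ₗ[R] A)).ofConv := by
  ext c
  simp [LinearMap.convOne_def]

lemma LinearMap.map_antipode_comul_left_inv [IsCocomm R C] :
    toConv (TensorProduct.map (antipode R) (antipode R) ∘ₗ comul (R := R) (A := C)) *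
      toConv (comul (R := R) (A := C)) = 1 := by
  have h := LinearMap.convMul_comp_coalgHom_distrib
    (toConv (TensorProduct.map (antipode R (A := C)) (antipode R (A := C))))
    (toConv (TensorProduct.map (LinearMap.id (R := R) (M := C)) LinearMap.id))
    (comulCoalgHom R C)
  have hmap := TensorProduct.map_convMul_map (f := toConv (antipode R (A := C)))
    (h := toConv LinearMap.id) (g := toConv (antipode R (A := C))) (k := toConv LinearMap.id)
  have hone : toConv (TensorProduct.map (1 : WithConv (C →ₗ[R] C)).ofConv
      (1 : WithConv (C →ₗ[R] C)).ofConv) = 1 := by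
    ext a b
    simp [LinearMap.convOne_def, Algebra.algebraMap_eq_smul_one, TensorProduct.smul_tmul', smul_smul,
      Algebra.TensorProduct.one_def, mul_comm]
  rw [LinearMap.antipode_mul_id, hone] at hmap
  have hcomul : (comulCoalgHom R C).toLinearMap = comul (R := R) (A := C) := rfl
  simp only at hmap
  rw [hmap, convOne_comp_coalgHom, hcomul, TensorProduct.map_id] at h
  exact WithConv.ext h.symm

variable (R C) in
/-- The antipode of a cocommutative Hopf algebra as a coalgebra homomorphism. -/
def HopfAlgebra.antipodeCoalgHom [IsCocomm R C] : C →ₗc[R] C where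
  __ := antipode R
  counit_comp := counit_comp_antipode
  map_comp_comul := toConv_injective <|
    left_inv_eq_right_inv LinearMap.map_antipode_comul_left_inv LinearMap.comul_right_inv

variable (R C) in
/-- `c ↦ S(c₁) ⊗ c₂`. -/
def antipodeLeftCoalgHom [IsCocomm R C] : C →ₗc[R] C ⊗[R] C :=
  (Coalgebra.TensorProduct.map (antipodeCoalgHom R C) (CoalgHom.id R C)).comp (comulCoalgHom R C)

variable (R C) in
/-- `c ↦ c₁ ⊗ S(c₂)`. -/
def antipodeRightCoalgHom [IsCocomm R C] : C →ₗc[R] C ⊗[R] C :=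
  (Coalgebra.TensorProduct.map (CoalgHom.id R C) (antipodeCoalgHom R C)).comp (comulCoalgHom R C)

lemma antipodeLeftCoalgHom_toLinearMap [IsCocomm R C] :
    (antipodeLeftCoalgHom R C).toLinearMap = (antipode R).rTensor C ∘ₗ comul := rfl

lemma antipodeRightCoalgHom_toLinearMap [IsCocomm R C] :
    (antipodeRightCoalgHom R C).toLinearMap = (antipode R).lTensor C ∘ₗ comul := rfl

lemma linearMap_comp_convMul {D : Type*} [AddCommGroup D] [Module R D] [Coalgebra R D]
    (f g : WithConv (D →ₗ[R] R)) :
    toConv (Algebra.linearMap R A ∘ₗ (f * g).ofConv) =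
      toConv (Algebra.linearMap R A ∘ₗ f.ofConv) * toConv (Algebra.linearMap R A ∘ₗ g.ofConv) :=
  WithConv.ext <| LinearMap.algHom_comp_convMul_distrib (Algebra.ofId R A) f g

lemma linearMap_comp_convMul_comm {D : Type*} [AddCommGroup D] [Module R D] [Coalgebra R D]
    [IsCocomm R D] (f : D →ₗ[R] R) (g : WithConv (D →ₗ[R] A)) :
    Commute (toConv (Algebra.linearMap R A ∘ₗ f)) g := by
  ext c
  rw [LinearMap.convMul_apply, ← comm_comul R c, LinearMap.convMul_apply]
  generalize comul (R := R) c = z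
  induction z with
  | zero => simp
  | add x y hx hy => simp only [map_add, hx, hy]
  | tmul a b => simp [Algebra.commutes]

end Convolution

section TwistedRepresentation

variable {R C A : Type*} [CommRing R] [Ring C] [HopfAlgebra R C] [Ring A] [Algebra R A]

lemma comp_mul'_antipodeLeft [IsCocomm R C] (ρ : C →ₗ[R] A) (hρ : ρ 1 = 1) :
    toConv ((ρ ∘ₗ LinearMap.mul' R C) ∘ₗ (antipodeLeftCoalgHom R C).toLinearMap) = 1 := by
  rw [antipodeLeftCoalgHom_toLinearMap]
  ext c
  simp [Algebra.algebraMap_eq_smul_one, hρ]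

lemma comp_mul'_antipodeRight [IsCocomm R C] (ρ : C →ₗ[R] A) (hρ : ρ 1 = 1) :
    toConv ((ρ ∘ₗ LinearMap.mul' R C) ∘ₗ (antipodeRightCoalgHom R C).toLinearMap) = 1 := by
  rw [antipodeRightCoalgHom_toLinearMap]
  ext c
  simp [Algebra.algebraMap_eq_smul_one, hρ]

lemma convMul_antipode_of_antihom [IsCocomm R C] (ρ : C →ₗ[R] A) (μ : C ⊗[R] C →ₗ[R] C)
    (hμ : ∀ a b, ρ b * ρ a = ρ (μ (a ⊗ₜ b))) :
    toConv ρ * toConv (ρ ∘ₗ antipode R) =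
      toConv ((ρ ∘ₗ μ) ∘ₗ (antipodeLeftCoalgHom R C).toLinearMap) := by
  rw [antipodeLeftCoalgHom_toLinearMap]
  ext c
  simp only [LinearMap.convMul_apply, LinearMap.comp_apply]
  conv_lhs => rw [← comm_comul R c]
  generalize comul (R := R) c = z
  induction z with
  | zero => simp
  | add x y hx hy => simp only [map_add, hx, hy]
  | tmul a b => simp [hμ]

lemma antipode_convMul_of_antihom [IsCocomm R C] (ρ : C →ₗ[R] A) (μ : C ⊗[R] C →ₗ[R] C)
    (hμ : ∀ a b, ρ b * ρ a = ρ (μ (a ⊗ₜ b))) :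
    toConv (ρ ∘ₗ antipode R) * toConv ρ =
      toConv ((ρ ∘ₗ μ) ∘ₗ (antipodeRightCoalgHom R C).toLinearMap) := by
  rw [antipodeRightCoalgHom_toLinearMap]
  ext c
  simp only [LinearMap.convMul_apply, LinearMap.comp_apply]
  conv_lhs => rw [← comm_comul R c]
  generalize comul (R := R) c = z
  induction z with
  | zero => simp
  | add x y hx hy => simp only [map_add, hx, hy]
  | tmul a b => simp [hμ]

/-- If the multiplication `μ` of a twisted algebra is `σ * mul` then, along a coalgebra
homomorphism on which the untwisted product is trivial, `ρ ∘ μ` is the scalar `σ`. -/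
lemma comp_twistMul_comp_coalgHom (ρ : C →ₗ[R] A) (μ : C ⊗[R] C →ₗ[R] C)
    (σ : C ⊗[R] C →ₗ[R] R)
    (hμ : toConv μ = toConv (Algebra.linearMap R C ∘ₗ σ) * toConv (LinearMap.mul' R C))
    (d : C →ₗc[R] C ⊗[R] C)
    (hd : toConv ((ρ ∘ₗ LinearMap.mul' R C) ∘ₗ d.toLinearMap) = 1) :
    toConv ((ρ ∘ₗ μ) ∘ₗ d.toLinearMap) =
      toConv (Algebra.linearMap R A ∘ₗ σ ∘ₗ d.toLinearMap) := by
  have hρμ : toConv (ρ ∘ₗ μ) =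
      toConv (Algebra.linearMap R A ∘ₗ σ) * toConv (ρ ∘ₗ LinearMap.mul' R C) := by
    have hμ' : μ = _ := congr(ofConv $hμ)
    rw [hμ']
    ext1
    simp only [LinearMap.convMul_def]
    rw [← LinearMap.comp_assoc, ← LinearMap.comp_assoc, ← LinearMap.comp_assoc]
    congr 1
    refine TensorProduct.ext' fun a b => ?_
    simp [Algebra.algebraMap_eq_smul_one]
  have h := LinearMap.convMul_comp_coalgHom_distrib (toConv (Algebra.linearMap R A ∘ₗ σ))
    (toConv (ρ ∘ₗ LinearMap.mul' R C)) d
  rw [← hρμ, hd, mul_one] at h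
  exact WithConv.ext h

/-- The convolution inverse of a representation of the twisted algebra. -/
def twistInv [IsCocomm R C] (ρ : C →ₗ[R] A) (σ' : C ⊗[R] C →ₗ[R] R) : WithConv (C →ₗ[R] A) :=
  toConv (ρ ∘ₗ antipode R) *
    toConv (Algebra.linearMap R A ∘ₗ σ' ∘ₗ (antipodeLeftCoalgHom R C).toLinearMap)

lemma linearMap_comp_convMul_eq_one (σ σ' : C ⊗[R] C →ₗ[R] R)
    (hσ : toConv σ * toConv σ' = 1) (d : C →ₗc[R] C ⊗[R] C) :
    toConv (Algebra.linearMap R A ∘ₗ σ ∘ₗ d.toLinearMap) *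
      toConv (Algebra.linearMap R A ∘ₗ σ' ∘ₗ d.toLinearMap) = 1 := by
  have h := LinearMap.convMul_comp_coalgHom_distrib (toConv σ) (toConv σ') d
  rw [hσ, convOne_comp_coalgHom] at h
  have h2 := linearMap_comp_convMul (A := A) (toConv (σ ∘ₗ d.toLinearMap))
    (toConv (σ' ∘ₗ d.toLinearMap))
  refine h2.symm.trans ?_
  rw [← h]
  ext c
  simp [LinearMap.convOne_def]

lemma convMul_twistInv [IsCocomm R C] (ρ : C →ₗ[R] A) (hρ : ρ 1 = 1) (μ : C ⊗[R] C →ₗ[R] C)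
    (hρμ : ∀ a b, ρ b * ρ a = ρ (μ (a ⊗ₜ b))) (σ σ' : C ⊗[R] C →ₗ[R] R)
    (hμ : toConv μ = toConv (Algebra.linearMap R C ∘ₗ σ) * toConv (LinearMap.mul' R C))
    (hσ : toConv σ * toConv σ' = 1) :
    toConv ρ * twistInv ρ σ' = 1 := by
  rw [twistInv, ← mul_assoc, convMul_antipode_of_antihom ρ μ hρμ,
    comp_twistMul_comp_coalgHom ρ μ σ hμ _ (comp_mul'_antipodeLeft ρ hρ),
    linearMap_comp_convMul_eq_one σ σ' hσ]

lemma twistInv_convMul [IsCocomm R C] (ρ : C →ₗ[R] A) (hρ : ρ 1 = 1) (μ : C ⊗[R] C →ₗ[R] C)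
    (hρμ : ∀ a b, ρ b * ρ a = ρ (μ (a ⊗ₜ b))) (σ σ' : C ⊗[R] C →ₗ[R] R)
    (hμ : toConv μ = toConv (Algebra.linearMap R C ∘ₗ σ) * toConv (LinearMap.mul' R C))
    (hσ : toConv σ * toConv σ' = 1) :
    twistInv ρ σ' * toConv ρ = 1 := by
  have hleft : (toConv (Algebra.linearMap R A ∘ₗ σ' ∘ₗ (antipodeRightCoalgHom R C).toLinearMap) *
      toConv (ρ ∘ₗ antipode R)) * toConv ρ = 1 := by
    rw [mul_assoc, antipode_convMul_of_antihom ρ μ hρμ,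
      comp_twistMul_comp_coalgHom ρ μ σ hμ _ (comp_mul'_antipodeRight ρ hρ),
      (linearMap_comp_convMul_comm _ _).eq, linearMap_comp_convMul_eq_one σ σ' hσ]
  rw [← left_inv_eq_right_inv hleft (convMul_twistInv ρ hρ μ hρμ σ σ' hμ hσ), hleft]

end TwistedRepresentation

section ConvAction

variable {R C N : Type*} [CommRing R] [Ring C] [HopfAlgebra R C] [AddCommGroup N] [Module R N]

/-- `c ⊗ x ↦ c₁ ⊗ φ(c₂) x`. -/
def convAct (φ : C →ₗ[R] Module.End R N) : C ⊗[R] N →ₗ[R] C ⊗[R] N :=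
  LinearMap.lTensor C (TensorProduct.lift φ) ∘ₗ (TensorProduct.assoc R C C N).toLinearMap ∘ₗ
    LinearMap.rTensor N comul

lemma convAct_tmul (φ : C →ₗ[R] Module.End R N) (c : C) (x : N) :
    convAct φ (c ⊗ₜ x) = LinearMap.lTensor C (φ.flip x) (comul (R := R) c) := by
  simp only [convAct, LinearMap.comp_apply, LinearMap.rTensor_tmul]
  generalize comul (R := R) c = z
  induction z with
  | zero => simp
  | add x y hx hy => simp only [map_add, TensorProduct.add_tmul, hx, hy]
  | tmul a b => simp

lemma convAct_one : convAct (1 : WithConv (C →ₗ[R] Module.End R N)).ofConv = LinearMap.id := by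
  refine TensorProduct.ext' fun c x => ?_
  have h : (1 : WithConv (C →ₗ[R] Module.End R N)).ofConv.flip x =
      LinearMap.toSpanSingleton R N x ∘ₗ counit := by
    ext a; simp [LinearMap.convOne_def]
  rw [convAct_tmul, h, LinearMap.lTensor_comp_apply, Coalgebra.lTensor_counit_comul]
  simp

lemma convAct_convMul (φ ψ : WithConv (C →ₗ[R] Module.End R N)) :
    convAct (φ * ψ).ofConv = convAct φ.ofConv ∘ₗ convAct ψ.ofConv := by
  refine TensorProduct.ext' fun c x => ?_
  let K : C ⊗[R] C →ₗ[R] N := TensorProduct.lift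
    ((LinearMap.lcomp R N (ψ.ofConv.flip x)) ∘ₗ φ.ofConv)
  have hK : (φ * ψ).ofConv.flip x = K ∘ₗ comul := by
    ext a
    simp only [LinearMap.flip_apply, LinearMap.convMul_def, LinearMap.comp_apply]
    generalize comul (R := R) a = z
    induction z with
    | zero => simp
    | add x y hx hy => simp only [map_add, LinearMap.add_apply, hx, hy]
    | tmul a b => simp [K]
  rw [LinearMap.comp_apply, convAct_tmul, convAct_tmul, hK, LinearMap.lTensor_comp_apply,
    ← Coalgebra.coassoc_apply]
  generalize comul (R := R) c = z
  induction z with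
  | zero => simp
  | add x y hx hy => simp only [map_add, hx, hy]
  | tmul a b =>
    simp only [LinearMap.lTensor_tmul, LinearMap.rTensor_tmul, convAct_tmul]
    generalize comul (R := R) a = z
    induction z with
    | zero => simp
    | add x y hx hy => simp only [map_add, TensorProduct.add_tmul, hx, hy]
    | tmul a b => simp [K]

lemma convAct_tmul_swap [IsCocomm R C] (φ : C →ₗ[R] Module.End R N) (c : C) (x : N) :
    convAct φ (c ⊗ₜ x) =
      TensorProduct.comm R N C (LinearMap.rTensor C (φ.flip x) (comul (R := R) c)) := by
  rw [convAct_tmul]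
  conv_lhs => rw [← comm_comul R c]
  generalize comul (R := R) c = z
  induction z with
  | zero => simp
  | add x y hx hy => simp only [map_add, hx, hy]
  | tmul a b => simp

end ConvAction

section TensorPowers

variable {K : Type} [Field K] {V : Type} [AddCommGroup V] [Module K V]

lemma exists_list_tpow (n : ℕ) (x : Tpow K V n) :
    ∃ l : List (Fin (n + 1) → V), (l.map (tpow K V n)).sum = x := by
  induction n with
  | zero => exact ⟨[fun _ => x], add_zero (M := V) x⟩
  | succ n ih =>
    change V ⊗[K] Tpow K V n at x
    induction x with
    | zero => exact ⟨[], rfl⟩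
    | add x y hx hy =>
      obtain ⟨l, rfl⟩ := hx
      obtain ⟨l', rfl⟩ := hy
      exact ⟨l ++ l', by rw [List.map_append, List.sum_append]; rfl⟩
    | tmul a y =>
      obtain ⟨l, rfl⟩ := ih y
      refine ⟨l.map (Fin.cons a), ?_⟩
      induction l with
      | nil => exact (TensorProduct.tmul_zero _ a).symm
      | cons f l hl =>
        simp only [List.map_cons, List.sum_cons, hl]
        exact (TensorProduct.tmul_add a _ _).symm

variable {C : Type} [Ring C] [HopfAlgebra K C] {M : Type} [AddCommGroup M] [Module K M]

lemma nonempty_iterRepr (n : ℕ) (c : C) : Nonempty (IterRepr K C n c) := by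
  obtain ⟨l, hl⟩ := exists_list_tpow n (comulIter K C n c)
  refine ⟨⟨Fin l.length, Finset.univ, fun i => l[i], ?_⟩⟩
  rw [← hl, ← Fin.sum_univ_fun_getElem]
  rfl

lemma IterRepr.comul_eq {c : C} (R : IterRepr K C 1 c) :
    ∑ i ∈ R.s, R.leg i 0 ⊗ₜ[K] R.leg i 1 = comul (R := K) c := by
  have h : comulIter K C 1 c = comul (R := K) c := LinearMap.congr_fun
    (LinearMap.lTensor_id C C : LinearMap.lTensor C (LinearMap.id : C →ₗ[K] C) = _) _
  exact R.eq.trans h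

lemma IterRepr.comul_comul_eq {c : C} (R : IterRepr K C 3 c) :
    ∑ i ∈ R.s, R.leg i 0 ⊗ₜ[K] (R.leg i 1 ⊗ₜ[K] (R.leg i 2 ⊗ₜ[K] R.leg i 3)) =
      LinearMap.lTensor C (LinearMap.lTensor C comul ∘ₗ comul) (comul (R := K) c) := by
  have h (D : C →ₗ[K] C ⊗[K] C) (hD : D = comul) :
      LinearMap.lTensor C (LinearMap.lTensor C D ∘ₗ comul) (comul (R := K) c) =
        LinearMap.lTensor C (LinearMap.lTensor C comul ∘ₗ comul) (comul (R := K) c) := by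
    rw [hD]
  refine R.eq.trans (h (comulIter K C 1) (LinearMap.ext fun a => ?_))
  exact LinearMap.congr_fun
    (LinearMap.lTensor_id C C : LinearMap.lTensor C (LinearMap.id : C →ₗ[K] C) = _) (comul a)

lemma TpowM.hom_ext (n : ℕ) {W : Type} [AddCommGroup W] [Module K W]
    {g h : (TpowM K C M n : Type) →ₗ[K] W}
    (hgh : ∀ f m, g (tpowM K C M n f m) = h (tpowM K C M n f m)) : g = h := by
  induction n with
  | zero => exact LinearMap.ext fun m => hgh (fun i => i.elim0) m
  | succ n ih =>
    refine TensorProduct.ext' (M := C) (N := TpowM K C M n) fun a y => ?_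
    let g' : C ⊗[K] TpowM K C M n →ₗ[K] W := g
    let h' : C ⊗[K] TpowM K C M n →ₗ[K] W := h
    exact LinearMap.congr_fun (ih (g := TensorProduct.curry g' a) (h := TensorProduct.curry h' a)
      fun f m => hgh (Fin.cons a f) m) y

variable (K C M) in
/-- The action on the last factor of `C^{⊗n} ⊗ M`. -/
def TpowM.act (ract : C →ₗ[K] M →ₗ[K] M) :
    (n : ℕ) → C →ₗ[K] Module.End K (TpowM K C M n)
  | 0 => ract
  | n + 1 => (LinearMap.lTensorHom C ∘ₗ TpowM.act ract n :
      C →ₗ[K] Module.End K (C ⊗[K] TpowM K C M n))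

lemma TpowM.act_tpowM (ract : C →ₗ[K] M →ₗ[K] M) (n : ℕ) (c : C) (f : Fin n → C) (m : M) :
    TpowM.act K C M ract n c (tpowM K C M n f m) = tpowM K C M n f (ract c m) := by
  induction n with
  | zero => rfl
  | succ n ih => exact congr(f 0 ⊗ₜ[K] $(ih fun i => f i.succ))

lemma TpowM.act_one (ract : C →ₗ[K] M →ₗ[K] M) (h1 : ∀ m, ract 1 m = m) (n : ℕ) :
    TpowM.act K C M ract n 1 = 1 :=
  TpowM.hom_ext n fun f m => by rw [TpowM.act_tpowM, h1]; rfl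

lemma TpowM.act_mul (ract : C →ₗ[K] M →ₗ[K] M) (μ : C →ₗ[K] C →ₗ[K] C)
    (hμ : ∀ a b m, ract b (ract a m) = ract (μ a b) m) (n : ℕ) (a b : C) :
    TpowM.act K C M ract n b * TpowM.act K C M ract n a = TpowM.act K C M ract n (μ a b) :=
  TpowM.hom_ext n fun f m => by
    rw [Module.End.mul_apply, TpowM.act_tpowM, TpowM.act_tpowM, TpowM.act_tpowM, hμ]

variable (K C M) in
/-- `Θ`, built recursively. -/
def thetaMap (ract : C →ₗ[K] M →ₗ[K] M) : (n : ℕ) → Module.End K (TpowM K C M n)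
  | 0 => LinearMap.id
  | n + 1 => (LinearMap.lTensor C (thetaMap ract n) ∘ₗ convAct (TpowM.act K C M ract n) :
      Module.End K (C ⊗[K] TpowM K C M n))

variable (K C M) in
/-- `𝔗`, built recursively. -/
def tfrakMap [IsCocomm K C] (σ' : C ⊗[K] C →ₗ[K] K) (ract : C →ₗ[K] M →ₗ[K] M) :
    (n : ℕ) → Module.End K (TpowM K C M n)
  | 0 => LinearMap.id
  | n + 1 => (convAct (twistInv (TpowM.act K C M ract n) σ').ofConv ∘ₗ
      LinearMap.lTensor C (tfrakMap σ' ract n) : Module.End K (C ⊗[K] TpowM K C M n))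

lemma Fin.sum_piFinset_succ {n : ℕ} {ι : Fin (n + 1) → Type} {W : Type} [AddCommMonoid W]
    (s : ∀ i, Finset (ι i)) (F : (∀ i, ι i) → W) :
    ∑ e ∈ Fintype.piFinset s, F e =
      ∑ a ∈ s 0, ∑ e ∈ Fintype.piFinset (fun i : Fin n => s i.succ), F (Fin.cons a e) := by
  rw [← Finset.sum_product']
  refine Finset.sum_nbij' (fun e => (e 0, Fin.tail e)) (fun p => Fin.cons p.1 p.2) ?_ ?_ ?_ ?_ ?_
  · intro e he
    simpa [Fin.forall_fin_succ, Fin.tail] using he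
  · intro p hp
    simpa [Fin.forall_fin_succ, Fin.tail] using hp
  all_goals simp

lemma convMul_tmul_iterRepr {A : Type} [Ring A] [Algebra K A] (f g : WithConv (C ⊗[K] C →ₗ[K] A))
    {a b : C} (Ra : IterRepr K C 1 a) (Rb : IterRepr K C 1 b) :
    (f * g).ofConv (a ⊗ₜ b) = ∑ i ∈ Ra.s, ∑ j ∈ Rb.s,
      f.ofConv (Ra.leg i 0 ⊗ₜ Rb.leg j 0) * g.ofConv (Ra.leg i 1 ⊗ₜ Rb.leg j 1) := by
  rw [LinearMap.convMul_apply, TensorProduct.comul_tmul, ← Ra.comul_eq, ← Rb.comul_eq]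
  simp [TensorProduct.sum_tmul, TensorProduct.tmul_sum]
  exact Finset.sum_comm

lemma IsConvInvPair.convMul_eq_one {sg sg' : C →ₗ[K] C →ₗ[K] K} (h : IsConvInvPair K C sg sg') :
    toConv (TensorProduct.lift sg) * toConv (TensorProduct.lift sg') = 1 := by
  refine WithConv.ext <| TensorProduct.ext' fun a b => ?_
  obtain ⟨Ra⟩ := nonempty_iterRepr (K := K) 1 a
  obtain ⟨Rb⟩ := nonempty_iterRepr (K := K) 1 b
  rw [convMul_tmul_iterRepr _ _ Ra Rb]
  simpa [LinearMap.convOne_def, mul_comm] using (h a b Ra Rb).1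

lemma IsTwistMul.toConv_eq {sg : C →ₗ[K] C →ₗ[K] K} {mu : C →ₗ[K] C →ₗ[K] C}
    (h : IsTwistMul K C sg mu) :
    toConv (TensorProduct.lift mu) = toConv (Algebra.linearMap K C ∘ₗ TensorProduct.lift sg) *
      toConv (LinearMap.mul' K C) := by
  refine WithConv.ext <| TensorProduct.ext' fun a b => ?_
  obtain ⟨Ra⟩ := nonempty_iterRepr (K := K) 1 a
  obtain ⟨Rb⟩ := nonempty_iterRepr (K := K) 1 b
  rw [convMul_tmul_iterRepr _ _ Ra Rb]
  simpa [Algebra.algebraMap_eq_smul_one] using h a b Ra Rb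

variable [IsCocomm K C] {N : Type} [AddCommGroup N] [Module K N]

lemma convAct_tmul_iterRepr (φ : C →ₗ[K] Module.End K N) {c : C} (R : IterRepr K C 1 c) (x : N) :
    convAct φ (c ⊗ₜ x) = ∑ i ∈ R.s, R.leg i 1 ⊗ₜ[K] φ (R.leg i 0) x := by
  rw [convAct_tmul_swap, ← R.comul_eq]
  simp

lemma convAct_scalar_tmul (σ' : C ⊗[K] C →ₗ[K] K) (c : C) (y : N) :
    convAct (Algebra.linearMap K (Module.End K N) ∘ₗ σ' ∘ₗ
        (antipodeLeftCoalgHom K C).toLinearMap) (c ⊗ₜ y) =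
      (TensorProduct.lid K C (LinearMap.rTensor C (σ' ∘ₗ LinearMap.rTensor C (antipode K))
        ((TensorProduct.assoc K C C C).symm (LinearMap.lTensor C comul (comul c))))) ⊗ₜ[K] y := by
  rw [convAct_tmul_swap, Coalgebra.coassoc_symm_apply, antipodeLeftCoalgHom_toLinearMap]
  generalize comul (R := K) c = z
  induction z with
  | zero => simp
  | add x y hx hy => simp only [map_add, TensorProduct.add_tmul, hx, hy]
  | tmul a b => simp [TensorProduct.smul_tmul]

lemma convAct_twistInv_tmul_iterRepr (ρ : C →ₗ[K] Module.End K N) (σ' : C ⊗[K] C →ₗ[K] K) {c : C}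
    (R : IterRepr K C 3 c) (x : N) :
    convAct (twistInv ρ σ').ofConv (c ⊗ₜ x) =
      ∑ i ∈ R.s, σ' (antipode K (R.leg i 1) ⊗ₜ R.leg i 2) •
        (R.leg i 3 ⊗ₜ[K] ρ (antipode K (R.leg i 0)) x) := by
  let W : C ⊗[K] (C ⊗[K] C) →ₗ[K] C := (TensorProduct.lid K C).toLinearMap ∘ₗ
    LinearMap.rTensor C (σ' ∘ₗ LinearMap.rTensor C (antipode K)) ∘ₗ
      (TensorProduct.assoc K C C C).symm.toLinearMap
  have key : convAct (twistInv ρ σ').ofConv (c ⊗ₜ x) = TensorProduct.comm K N C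
      (TensorProduct.map ((ρ ∘ₗ antipode K).flip x) W
        (LinearMap.lTensor C (LinearMap.lTensor C comul ∘ₗ comul) (comul (R := K) c))) := by
    rw [twistInv, ← (linearMap_comp_convMul_comm _ _).eq, convAct_convMul, LinearMap.comp_apply,
      ofConv_toConv, ofConv_toConv, convAct_tmul_swap]
    generalize comul (R := K) c = z
    induction z with
    | zero => simp
    | add x y hx hy => simp only [map_add, hx, hy]
    | tmul a b =>
      simp only [LinearMap.rTensor_tmul, TensorProduct.comm_tmul, convAct_scalar_tmul]
      simp [W]
  rw [key, ← R.comul_comul_eq]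
  simp [W, TensorProduct.smul_tmul']

lemma isTheta_thetaMap (ract : C →ₗ[K] M →ₗ[K] M) (n : ℕ) :
    IsTheta K C M ract n (thetaMap K C M ract n) := by
  induction n with
  | zero =>
    intro f m R
    simp [thetaMap]
    rfl
  | succ n ih =>
    intro f m R
    rw [Fin.sum_piFinset_succ]
    refine (congr(LinearMap.lTensor C (thetaMap K C M ract n) $(convAct_tmul_iterRepr
      (TpowM.act K C M ract n) (R 0) (tpowM K C M n (fun i => f i.succ) m)))).trans ?_
    rw [map_sum]
    refine Finset.sum_congr rfl fun a _ => ?_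
    rw [LinearMap.lTensor_tmul, TpowM.act_tpowM, ih _ _ fun i => R i.succ,
      TensorProduct.tmul_sum]
    refine Finset.sum_congr rfl fun e _ => ?_
    simp only [List.ofFn_succ, List.foldl_cons]
    rfl

lemma isTfrak_tfrakMap (sg' : C →ₗ[K] C →ₗ[K] K) (ract : C →ₗ[K] M →ₗ[K] M) (n : ℕ) :
    IsTfrak K C M sg' ract n (tfrakMap K C M (TensorProduct.lift sg') ract n) := by
  induction n with
  | zero =>
    intro f m R
    simp [tfrakMap]
    rfl
  | succ n ih =>
    intro f m R
    rw [Fin.sum_piFinset_succ]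
    refine (convAct_twistInv_tmul_iterRepr (TpowM.act K C M ract n) _ (R 0) _).trans ?_
    refine Finset.sum_congr rfl fun a _ => ?_
    rw [ih _ _ fun i => R i.succ, map_sum, TensorProduct.tmul_sum, Finset.smul_sum]
    refine Finset.sum_congr rfl fun e _ => ?_
    rw [map_smul, TensorProduct.tmul_smul, smul_smul, TpowM.act_tpowM, Fin.prod_univ_succ]
    simp only [List.ofFn_succ, List.reverse_cons, List.foldl_append, TensorProduct.lift.tmul]
    rfl

lemma IsTheta.eq_thetaMap {ract : C →ₗ[K] M →ₗ[K] M} {n : ℕ}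
    {Th : (TpowM K C M n : Type) →ₗ[K] (TpowM K C M n : Type)} (h : IsTheta K C M ract n Th) :
    Th = thetaMap K C M ract n :=
  TpowM.hom_ext n fun f m => by
    have R (i : Fin n) := Classical.choice (nonempty_iterRepr (K := K) 1 (f i))
    rw [h f m R, isTheta_thetaMap ract n f m R]

lemma IsTfrak.eq_tfrakMap {sg' : C →ₗ[K] C →ₗ[K] K} {ract : C →ₗ[K] M →ₗ[K] M} {n : ℕ}
    {Tf : (TpowM K C M n : Type) →ₗ[K] (TpowM K C M n : Type)}
    (h : IsTfrak K C M sg' ract n Tf) :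
    Tf = tfrakMap K C M (TensorProduct.lift sg') ract n :=
  TpowM.hom_ext n fun f m => by
    have R (i : Fin n) := Classical.choice (nonempty_iterRepr (K := K) 3 (f i))
    rw [h f m R, isTfrak_tfrakMap sg' ract n f m R]

lemma tfrakMap_thetaMap_inverse {ract : C →ₗ[K] M →ₗ[K] M} {σ' : C ⊗[K] C →ₗ[K] K}
    (hl : ∀ n, twistInv (TpowM.act K C M ract n) σ' * toConv (TpowM.act K C M ract n) = 1)
    (hr : ∀ n, toConv (TpowM.act K C M ract n) * twistInv (TpowM.act K C M ract n) σ' = 1)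
    (n : ℕ) :
    tfrakMap K C M σ' ract n ∘ₗ thetaMap K C M ract n = LinearMap.id ∧
      thetaMap K C M ract n ∘ₗ tfrakMap K C M σ' ract n = LinearMap.id := by
  induction n with
  | zero => exact ⟨rfl, rfl⟩
  | succ n ih =>
    have hl' : convAct (twistInv (TpowM.act K C M ract n) σ').ofConv ∘ₗ
        convAct (TpowM.act K C M ract n) = LinearMap.id := by
      rw [← convAct_one, ← hl n, convAct_convMul]
    have hr' : convAct (TpowM.act K C M ract n) ∘ₗ
        convAct (twistInv (TpowM.act K C M ract n) σ').ofConv = LinearMap.id := by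
      rw [← convAct_one, ← hr n, convAct_convMul]
    have ih₁ : LinearMap.lTensor C (tfrakMap K C M σ' ract n) ∘ₗ
        LinearMap.lTensor C (thetaMap K C M ract n) = LinearMap.id := by
      rw [← LinearMap.lTensor_comp, ih.1, LinearMap.lTensor_id]
    have ih₂ : LinearMap.lTensor C (thetaMap K C M ract n) ∘ₗ
        LinearMap.lTensor C (tfrakMap K C M σ' ract n) = LinearMap.id := by
      rw [← LinearMap.lTensor_comp, ih.2, LinearMap.lTensor_id]
    refine ⟨LinearMap.ext fun (x : C ⊗[K] TpowM K C M n) => ?_,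
      LinearMap.ext fun (x : C ⊗[K] TpowM K C M n) => ?_⟩
    · exact congr(convAct (twistInv (TpowM.act K C M ract n) σ').ofConv
        $(LinearMap.congr_fun ih₁ (convAct (TpowM.act K C M ract n) x))).trans
          (LinearMap.congr_fun hl' x)
    · exact congr(LinearMap.lTensor C (thetaMap K C M ract n) $(LinearMap.congr_fun hr'
        (LinearMap.lTensor C (tfrakMap K C M σ' ract n) x))).trans (LinearMap.congr_fun ih₂ x)

end TensorPowers

/-- Let `H` be cocommutative, `σ : H ⊗ H → k` a convolution invertible
normal 2-cocycle, `H_σ = k #_σ H`, and `M` an `H_σ`-bimodule. Then the maps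
`Θ(h̄₁ ⊗ ⋯ ⊗ h̄ₙ ⊗ m) = h₁⁽²⁾ ⊗ ⋯ ⊗ hₙ⁽²⁾ ⊗ m·h̄₁⁽¹⁾⋯h̄ₙ⁽¹⁾` and
`𝔗(h₁ ⊗ ⋯ ⊗ hₙ ⊗ m) = σ⁻¹(S(h₁⁽²⁾),h₁⁽³⁾)⋯σ⁻¹(S(hₙ⁽²⁾),hₙ⁽³⁾) ·
h̄₁⁽⁴⁾ ⊗ ⋯ ⊗ h̄ₙ⁽⁴⁾ ⊗ m·S(hₙ⁽¹⁾)‾⋯S(h₁⁽¹⁾)‾` are mutually inverse. -/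
theorem theta_tfrak_inverse
    (k : Type) [Field k] (H : Type) [Ring H] [HopfAlgebra k H]
    (hco : Cocomm k H)
    (sg sg' : H →ₗ[k] H →ₗ[k] k)
    (hnorm : NormalK k H sg) (hcoc : CocycleK k H sg)
    (hconv : IsConvInvPair k H sg sg')
    (M : Type) [AddCommGroup M] [Module k M]
    (mu : H →ₗ[k] H →ₗ[k] H) (hmu : IsTwistMul k H sg mu)
    (lact ract : H →ₗ[k] M →ₗ[k] M)
    (hbim : IsSigmaBimodule k H M mu lact ract)
    (n : ℕ)
    (Th Tf : (TpowM k H M n : Type) →ₗ[k] (TpowM k H M n : Type))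
    (hTh : IsTheta k H M ract n Th)
    (hTf : IsTfrak k H M sg' ract n Tf) :
    Tf ∘ₗ Th = LinearMap.id ∧ Th ∘ₗ Tf = LinearMap.id := by
  have : IsCocomm k H := ⟨LinearMap.ext hco⟩
  obtain ⟨-, -, hmul, hone, -⟩ := hbim
  rw [hTh.eq_thetaMap, hTf.eq_tfrakMap]
  exact tfrakMap_thetaMap_inverse
    (fun n => twistInv_convMul _ (TpowM.act_one ract hone n) (TensorProduct.lift mu)
      (TpowM.act_mul ract mu hmul n) _ _ hmu.toConv_eq hconv.convMul_eq_one)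
    (fun n => convMul_twistInv _ (TpowM.act_one ract hone n) (TensorProduct.lift mu)
      (TpowM.act_mul ract mu hmul n) _ _ hmu.toConv_eq hconv.convMul_eq_one) n
end
end
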